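/- arXiv:1908.08817 — 3 statements merged into one kernel-verified Lean document; each statement's English description precedes it below -/
import Mathlib

section
/- For every integer k ≥ 1 there exist a constant C > 0 and an integer D (both depending only on k) such that for all integers d ≥ D, 2^(d − C·(log₂ d)²) ≤ K(d,k) ≤ 2^d. In other words, log₂ K(d,k) = d + O(log² d) as d → ∞. -/
/-- Cyclic distance between two indices on a cycle of length `N`. -/
def cycDist {N : ℕ} (i j : ZMod N) : ℕ := min (j - i).val (i - j).val

/-- A `(d,k)` circuit code of length `N`: a simple cycle `x₁,…,x_N` in the
`d`-dimensional hypercube graph `I(d)` (vertices are binary vectors of length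
`d`, adjacency is Hamming distance `1`, and the graph distance in `I(d)` equals
the Hamming distance) such that for any two vertices of the cycle the graph
distance is at least the minimum of their distance along the cycle and `k`. -/
def IsCircuitCode (d k N : ℕ) (x : ZMod N → (Fin d → Bool)) : Prop :=
  3 ≤ N ∧ Function.Injective x ∧
    (∀ i : ZMod N, hammingDist (x i) (x (i + 1)) = 1) ∧
    (∀ i j : ZMod N, min (cycDist i j) k ≤ hammingDist (x i) (x j))

/-- `K d k`: the maximum length of a `(d,k)` circuit code. -/
noncomputable def K (d k : ℕ) : ℕ :=
  sSup {N | ∃ x : ZMod N → (Fin d → Bool), IsCircuitCode d k N x}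

lemma exists_gray_cycle (n : ℕ) :
    ∃ (x : ℕ → Fin (n + 1) → ZMod 2) (dir : ℕ → Fin (n + 1)),
      (∀ q, x (q + 1) = x q + Pi.single (dir q) 1) ∧
      Function.Periodic x (2 ^ (n + 1)) ∧
      Set.InjOn x (Set.Iio (2 ^ (n + 1))) := by
  induction n with
  | zero =>
    refine ⟨fun q _ => q, fun _ => 0, ?_, ?_, ?_⟩
    · intro q; funext i
      obtain rfl : i = 0 := by omega
      simp
    · intro q; funext i
      have : (2 : ZMod 2) = 0 := rfl
      simp [this]
    · intro q hq q' hq' h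
      have h0 := congrFun h 0
      simp only [ZMod.natCast_eq_natCast_iff'] at h0
      simp at hq hq'
      omega
  | succ n ih =>
    obtain ⟨x, dir, hstep, hper, hinj⟩ := ih
    refine ⟨fun q => Fin.cons (((q + 1) / 2 : ℕ) : ZMod 2) (x (q / 2)),
      fun q => if q % 2 = 0 then 0 else (dir (q / 2)).succ, ?_, ?_, ?_⟩
    · intro q
      rcases Nat.even_or_odd' q with ⟨m, rfl | rfl⟩
      · have h1 : (2 * m + 1 + 1) / 2 = m + 1 := by omega
        have h2 : (2 * m + 1) / 2 = m := by omega
        have h3 : (2 * m) / 2 = m := by omega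
        funext i
        refine Fin.cases ?_ (fun i => ?_) i <;> simp [h1, h2, h3]
      · have h1 : (2 * m + 1 + 1 + 1) / 2 = m + 1 := by omega
        have h2 : (2 * m + 1 + 1) / 2 = m + 1 := by omega
        have h3 : (2 * m + 1) / 2 = m := by omega
        have h4 : (2 * m + 1) % 2 ≠ 0 := by omega
        funext i
        refine Fin.cases ?_ (fun i => ?_) i
        · simp [h1, h2, (Fin.succ_ne_zero _).symm]
        · simp [h2, h3, hstep, Pi.single_apply]
    · intro q
      have h1 : (q + 2 ^ (n + 1 + 1) + 1) / 2 = (q + 1) / 2 + 2 * 2 ^ n := by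
        rw [pow_succ, pow_succ]; omega
      have h2 : (q + 2 ^ (n + 1 + 1)) / 2 = q / 2 + 2 ^ (n + 1) := by
        rw [pow_succ]; omega
      have h3 : (2 : ZMod 2) = 0 := rfl
      simp only [h1, h2, hper (q / 2)]
      push_cast
      simp [h3]
    · intro q hq q' hq' h
      obtain ⟨h0, h1⟩ := Fin.cons_inj.1 h
      simp only [Set.mem_Iio, pow_succ 2 (n + 1)] at hq hq'
      have h2 := hinj (Set.mem_Iio.2 (by omega)) (Set.mem_Iio.2 (by omega)) h1
      rw [ZMod.natCast_eq_natCast_iff'] at h0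
      omega

lemma exists_isolating_code (k D n p : ℕ) [Fact p.Prime] (hp : k * D < p) (hn : n ≤ 2 ^ D) :
    ∃ code : Fin n → ZMod p → ZMod p, ∀ S : Finset (Fin n), S.Nonempty → S.card ≤ k + 1 →
      ∃ a, ∃ i ∈ S, ∀ j ∈ S, code j a = code i a → j = i := by
  classical
  have hcard : Fintype.card (Fin n) ≤ Fintype.card (Fin D → ZMod p) := by
    simpa [ZMod.card] using
      hn.trans (Nat.pow_le_pow_left (Fact.out : p.Prime).two_le D)
  obtain ⟨e⟩ := Function.Embedding.nonempty_of_card_le hcard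
  refine ⟨fun i a => (Polynomial.ofFn D (e i)).eval a, fun S ⟨i, hi⟩ hS => ?_⟩
  have hagree : ∀ j ≠ i, (Finset.univ.filter fun a : ZMod p =>
      (Polynomial.ofFn D (e j)).eval a = (Polynomial.ofFn D (e i)).eval a).card ≤ D := by
    intro j hj
    by_contra! hlt
    refine hj (e.injective (Polynomial.injective_ofFn D ?_))
    refine Polynomial.eq_of_degree_sub_lt_of_eval_finset_eq
      (Finset.univ.filter fun a : ZMod p =>
        (Polynomial.ofFn D (e j)).eval a = (Polynomial.ofFn D (e i)).eval a) ?_ (by simp)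
    refine (Polynomial.degree_sub_le _ _).trans_lt (max_lt ?_ ?_)
    all_goals exact lt_of_lt_of_le (Polynomial.ofFn_degree_lt _) (by exact_mod_cast hlt.le)
  have hbad : ((S.erase i).biUnion fun j => Finset.univ.filter fun a : ZMod p =>
      (Polynomial.ofFn D (e j)).eval a = (Polynomial.ofFn D (e i)).eval a).card
        < (Finset.univ : Finset (ZMod p)).card := by
    refine (Finset.card_biUnion_le_card_mul _ _ D fun j hj =>
      hagree j (Finset.ne_of_mem_erase hj)).trans_lt ?_
    rw [Finset.card_erase_of_mem hi, Finset.card_univ, ZMod.card]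
    exact (Nat.mul_le_mul_right D (by omega)).trans_lt hp
  obtain ⟨a, -, ha⟩ := Finset.exists_mem_notMem_of_card_lt_card hbad
  refine ⟨a, i, hi, fun j hj h => ?_⟩
  by_contra hne
  exact ha (by simpa using ⟨j, ⟨hne, hj⟩, h⟩)

/-- Number of times `u < t` with `u ≡ φ` modulo `M + 1`. -/
def slotCount (M φ t : ℕ) : ℕ := (t + (M - φ)) / (M + 1)

lemma slotCount_eq {M φ : ℕ} (hφ : φ ≤ M) (t : ℕ) :
    slotCount M φ t = t / (M + 1) + if φ < t % (M + 1) then 1 else 0 := by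
  have h := Nat.div_add_mod t (M + 1)
  have hr := Nat.mod_lt t M.succ_pos
  rw [slotCount]
  generalize t / (M + 1) = q at *
  generalize t % (M + 1) = r at *
  subst h
  rw [add_assoc, Nat.mul_add_div M.succ_pos]
  split_ifs with hlt
  · congr 1
    exact (Nat.div_eq_iff M.succ_pos).2 (by omega)
  · congr 1
    exact Nat.div_eq_of_lt (by omega)

lemma slotCount_succ {M φ : ℕ} (hφ : φ ≤ M) (t : ℕ) :
    slotCount M φ (t + 1) = slotCount M φ t + if t % (M + 1) = φ then 1 else 0 := by
  have h := Nat.div_add_mod t (M + 1)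
  have hr := Nat.mod_lt t M.succ_pos
  simp only [slotCount_eq hφ]
  generalize t / (M + 1) = q at *
  generalize t % (M + 1) = r at *
  subst h
  rw [add_assoc, Nat.mul_add_div M.succ_pos, Nat.mul_add_mod]
  rcases Nat.lt_or_ge r M with hrM | hrM
  · rw [Nat.div_eq_of_lt (by omega), Nat.mod_eq_of_lt (by omega)]
    split_ifs <;> omega
  · obtain rfl : r = M := by omega
    rw [Nat.div_self (Nat.succ_pos _), Nat.mod_self]
    split_ifs <;> omega

/-- If a slot count agrees at `s` and `t` modulo `W`, then `s` and `t` differ by at most `M`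
modulo `(M + 1) * W`. -/
lemma exists_shift_of_slotCount_modEq {M φ W s t : ℕ}
    (h : slotCount M φ s ≡ slotCount M φ t [MOD W]) :
    ∃ δ ≤ M, s + δ ≡ t [MOD (M + 1) * W] ∨ t + δ ≡ s [MOD (M + 1) * W] := by
  wlog hle : (s + (M - φ)) % (M + 1) ≤ (t + (M - φ)) % (M + 1) generalizing s t
  · obtain ⟨δ, hδ, h'⟩ := this h.symm (by omega)
    exact ⟨δ, hδ, h'.symm⟩
  refine ⟨(t + (M - φ)) % (M + 1) - (s + (M - φ)) % (M + 1), ?_, Or.inl ?_⟩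
  · have := Nat.mod_lt (t + (M - φ)) (by omega : 0 < M + 1)
    omega
  · refine Nat.ModEq.add_right_cancel' (M - φ) ?_
    have hs := Nat.div_add_mod (s + (M - φ)) (M + 1)
    have ht := Nat.div_add_mod (t + (M - φ)) (M + 1)
    have h1 := (Nat.ModEq.mul_left' (M + 1) h).add_right ((t + (M - φ)) % (M + 1))
    unfold slotCount at h1
    rw [ht] at h1
    convert h1 using 1
    omega

section SlotWalk

variable {n M : ℕ} {ι : Type*}

/-- The letter flipped at time `t`: that of slot `t % (M + 1)` encoding the direction of step
`t / (M + 1)`. -/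
def slotFlip (g : Fin (M + 1) → Fin n → ι) (dir : ℕ → Fin n) (t : ℕ) : ι :=
  g ⟨t % (M + 1), Nat.mod_lt _ M.succ_pos⟩ (dir (t / (M + 1)))

variable {slot : ι → Fin (M + 1)} {g : Fin (M + 1) → Fin n → ι} {x : ℕ → Fin n → ZMod 2}
  {dir : ℕ → Fin n}

lemma slotFlip_injOn (hg : ∀ φ i, slot (g φ i) = φ) (s : ℕ) {δ : ℕ} (hδ : δ ≤ M + 1) :
    Set.InjOn (fun u => slotFlip g dir (s + u)) (Finset.range δ) := by
  intro u hu v hv h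
  have h1 := congrArg (fun c => (slot c : ℕ)) h
  simp only [slotFlip, hg] at h1
  have h2 : u ≡ v [MOD M + 1] := Nat.ModEq.add_left_cancel' s h1
  simp only [Finset.coe_range, Set.mem_Iio] at hu hv
  exact h2.eq_of_lt_of_lt (by omega) (by omega)

variable [DecidableEq ι]

/-- The position at time `t` of the walk which, at time `q * (M + 1) + φ`, flips the letter
`g φ i` of slot `φ`, where `i` is the direction of the `q`-th step of the walk `x`.
The letter `c` belongs to slot `slot c`. -/
def slotWalk (slot : ι → Fin (M + 1)) (g : Fin (M + 1) → Fin n → ι) (x : ℕ → Fin n → ZMod 2)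
    (t : ℕ) (c : ι) : ZMod 2 :=
  ∑ i, if g (slot c) i = c then x (slotCount M (slot c) t) i else 0

lemma slotWalk_succ (hg : ∀ φ i, slot (g φ i) = φ)
    (hx : ∀ q, x (q + 1) = x q + Pi.single (dir q) 1) (t : ℕ) :
    slotWalk slot g x (t + 1) = slotWalk slot g x t + Pi.single (slotFlip g dir t) 1 := by
  funext c
  have hle : (slot c : ℕ) ≤ M := Nat.le_of_lt_succ (slot c).2
  by_cases hc : t % (M + 1) = slot c
  · have hq : slotCount M (slot c) t = t / (M + 1) := by
      rw [slotCount_eq hle, if_neg (by omega), add_zero]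
    have hflip : slotFlip g dir t = g (slot c) (dir (t / (M + 1))) := by
      unfold slotFlip; congr 1; exact Fin.ext hc
    simp only [slotWalk, slotCount_succ hle, hc, if_true, hq, hx, Pi.add_apply, hflip,
      Pi.single_apply]
    rw [← sub_eq_iff_eq_add', ← Finset.sum_sub_distrib, Finset.sum_eq_single (dir (t / (M + 1)))]
    · by_cases h : g (slot c) (dir (t / (M + 1))) = c
      · rw [if_pos h, if_pos h, if_pos rfl, if_pos h.symm, add_sub_cancel_left]
      · rw [if_neg h, if_neg h, if_neg (Ne.symm h), sub_zero]
    · intro i _ hi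
      simp [hi]
    · simp
  · have hne : c ≠ slotFlip g dir t := by
      rintro rfl
      exact hc (by simp [slotFlip, hg])
    simp [slotWalk, slotCount_succ hle, hc, hne]

lemma slotWalk_add (hg : ∀ φ i, slot (g φ i) = φ)
    (hx : ∀ q, x (q + 1) = x q + Pi.single (dir q) 1) (s δ : ℕ) :
    slotWalk slot g x (s + δ) =
      slotWalk slot g x s + ∑ u ∈ Finset.range δ, Pi.single (slotFlip g dir (s + u)) 1 := by
  induction δ with
  | zero => simp
  | succ δ ih => rw [← add_assoc, slotWalk_succ hg hx, ih, Finset.sum_range_succ, add_assoc]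

lemma le_hammingDist_slotWalk [Fintype ι] (hg : ∀ φ i, slot (g φ i) = φ)
    (hx : ∀ q, x (q + 1) = x q + Pi.single (dir q) 1) (s : ℕ) {δ : ℕ} (hδ : δ ≤ M + 1) :
    δ ≤ hammingDist (slotWalk slot g x s) (slotWalk slot g x (s + δ)) := by
  have hinj := slotFlip_injOn (dir := dir) hg s hδ
  rw [slotWalk_add hg hx]
  conv_lhs => rw [← Finset.card_range δ]
  refine Finset.card_le_card_of_injOn (fun u => slotFlip g dir (s + u)) (fun u hu => ?_) hinj
  have hsum : (∑ v ∈ Finset.range δ, Pi.single (M := fun _ => ZMod 2)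
      (slotFlip g dir (s + v)) 1) (slotFlip g dir (s + u)) = 1 := by
    rw [Finset.sum_apply, Finset.sum_eq_single_of_mem u hu]
    · simp
    · intro v hv hne
      exact Pi.single_eq_of_ne (fun h => hne (hinj hu hv h).symm) _
  rw [Finset.mem_coe, Finset.mem_filter, Pi.add_apply, hsum]
  simp

lemma hammingDist_slotWalk_succ [Fintype ι] (hg : ∀ φ i, slot (g φ i) = φ)
    (hx : ∀ q, x (q + 1) = x q + Pi.single (dir q) 1) (t : ℕ) :
    hammingDist (slotWalk slot g x t) (slotWalk slot g x (t + 1)) = 1 := by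
  rw [slotWalk_succ hg hx, hammingDist, Finset.card_eq_one]
  refine ⟨slotFlip g dir t, ?_⟩
  ext c
  simp [Pi.single_apply]

lemma slotWalk_periodic {W : ℕ} (hper : Function.Periodic x W) :
    Function.Periodic (slotWalk slot g x) ((M + 1) * W) := by
  intro t
  funext c
  have h : slotCount M (slot c) (t + (M + 1) * W) = slotCount M (slot c) t + W := by
    unfold slotCount
    rw [add_right_comm, Nat.add_mul_div_left _ _ M.succ_pos]
  simp only [slotWalk, h, hper _]

end SlotWalk

/-- The letters of slot `0` are the directions of the underlying walk; each later slot has a copy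
of the alphabet `B`. -/
def blockSlot {n M : ℕ} {B : Type*} : Fin n ⊕ (Fin M × B) → Fin (M + 1) :=
  Sum.elim (fun _ => 0) (fun c => c.1.succ)

/-- The letter of a given slot encoding a direction. -/
def blockLetter {n M : ℕ} {B : Type*} (h : Fin M → Fin n → B) (φ : Fin (M + 1)) (i : Fin n) :
    Fin n ⊕ (Fin M × B) :=
  Fin.cases (Sum.inl i) (fun m => Sum.inr (m, h m i)) φ

lemma blockSlot_blockLetter {n M : ℕ} {B : Type*} (h : Fin M → Fin n → B) (φ : Fin (M + 1))
    (i : Fin n) : blockSlot (blockLetter h φ i) = φ := by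
  refine Fin.cases ?_ (fun m => ?_) φ <;> simp [blockSlot, blockLetter]

section Separation

variable {n k p : ℕ} {x : ℕ → Fin n → ZMod 2} {dir : ℕ → Fin n}

lemma hammingDist_slotCount_le (hx : ∀ q, x (q + 1) = x q + Pi.single (dir q) 1) {M φ : ℕ}
    (hφ : φ ≤ M) (s : ℕ) :
    hammingDist (x (slotCount M φ s)) (x (slotCount M 0 s)) ≤ 1 := by
  rcases (show slotCount M 0 s = slotCount M φ s ∨ slotCount M 0 s = slotCount M φ s + 1 by
    rw [slotCount_eq hφ, slotCount_eq M.zero_le]; split_ifs <;> omega) with h | h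
  · simp [h]
  · rw [h, hx, hammingDist, Finset.card_le_one]
    intro i hi j hj
    simp_all [Pi.single_apply]

lemma slotCount_block {c r : ℕ} {M s : ℕ} (hr : s % (M + 1) = r) (hc : c ≠ (r - 1) / p)
    {a : ℕ} (ha : a < p) (hm : c * p + a + 1 ≤ M) :
    slotCount M (c * p + a + 1) s = slotCount M (c * p + 1) s := by
  rw [slotCount_eq hm, slotCount_eq (by omega), hr]
  rcases lt_or_gt_of_ne hc with h | h
  · have h1 : (c + 1) * p ≤ r - 1 := (Nat.le_div_iff_mul_le (by omega)).1 h
    rw [add_mul] at h1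
    rw [if_pos (by omega), if_pos (by omega)]
  · have h1 : r - 1 < c * p := (Nat.div_lt_iff_lt_mul (by omega)).1 h
    rw [if_neg (by omega), if_neg (by omega)]

lemma exists_slotCount_eq_of_hammingDist_lt [NeZero p] {code : Fin n → ZMod p → ZMod p}
    (hcode : ∀ S : Finset (Fin n), S.Nonempty → S.card ≤ k + 1 →
      ∃ a, ∃ i ∈ S, ∀ j ∈ S, code j a = code i a → j = i)
    (hx : ∀ q, x (q + 1) = x q + Pi.single (dir q) 1) (s t : ℕ)
    (hst : hammingDist
      (slotWalk blockSlot (blockLetter fun (m : Fin ((k + 2) * p)) i => code i (m : ℕ)) x s)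
      (slotWalk blockSlot (blockLetter fun (m : Fin ((k + 2) * p)) i => code i (m : ℕ)) x t) < k) :
    ∃ φ, x (slotCount ((k + 2) * p) φ s) = x (slotCount ((k + 2) * p) φ t) := by
  by_contra! hne
  refine hst.not_ge ?_
  set M := (k + 2) * p with hM
  set h : Fin M → Fin n → ZMod p := fun m i => code i (m : ℕ) with hh
  have hp : 0 < p := NeZero.pos p
  have hzero : hammingDist (x (slotCount M 0 s)) (x (slotCount M 0 t)) < k := by
    refine lt_of_le_of_lt ?_ hst
    refine Finset.card_le_card_of_injOn Sum.inl (fun i hi => ?_) Sum.inl_injective.injOn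
    simp only [Finset.coe_filter, Finset.mem_univ, true_and, Set.mem_ofPred_eq] at hi ⊢
    simpa [slotWalk, blockSlot, blockLetter] using hi
  have hclose : ∀ φ ≤ M, hammingDist (x (slotCount M φ s)) (x (slotCount M φ t)) ≤ k + 1 := by
    intro φ hφ
    have h1 := hammingDist_slotCount_le hx hφ s
    have h2 := hammingDist_slotCount_le hx hφ t
    rw [hammingDist_comm] at h2
    have h3 := hammingDist_triangle (x (slotCount M φ s)) (x (slotCount M 0 s))
      (x (slotCount M φ t))
    have h4 := hammingDist_triangle (x (slotCount M 0 s)) (x (slotCount M 0 t))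
      (x (slotCount M φ t))
    omega
  have hmM : ∀ c < k + 2, ∀ a < p, c * p + a + 1 ≤ M := by
    intro c hc a ha
    have : (c + 1) * p ≤ M := Nat.mul_le_mul_right p hc
    rw [add_mul] at this
    omega
  let bad : Finset ℕ := {(s % (M + 1) - 1) / p, (t % (M + 1) - 1) / p}
  have hletter : ∀ c ∈ Finset.range (k + 2) \ bad, ∃ co : Fin n ⊕ (Fin M × ZMod p),
      ((blockSlot co : ℕ) - 1) / p = c ∧ slotWalk blockSlot (blockLetter h) x s co
        ≠ slotWalk blockSlot (blockLetter h) x t co := by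
    intro c hc
    simp only [Finset.mem_sdiff, Finset.mem_range, bad, Finset.mem_insert, Finset.mem_singleton,
      not_or] at hc
    obtain ⟨hck, hcs, hct⟩ := hc
    set α := x (slotCount M (c * p + 1) s) with hα
    set β := x (slotCount M (c * p + 1) t) with hβ
    obtain ⟨a, i, hi, hiso⟩ := hcode {i | α i ≠ β i}
      (by
        obtain ⟨i, hi⟩ := Function.ne_iff.1 (hne (c * p + 1))
        exact ⟨i, by simpa using hi⟩)
      (hclose _ (hmM c hck 0 hp))
    have ha : a.val < p := ZMod.val_lt a
    have hm := hmM c hck a.val ha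
    refine ⟨Sum.inr (⟨c * p + a.val, hm⟩, code i a), ?_, ?_⟩
    · simp only [blockSlot, Sum.elim_inr, Fin.val_succ, Nat.add_sub_cancel]
      rw [mul_comm, Nat.mul_add_div hp, Nat.div_eq_of_lt ha, add_zero]
    · simp only [slotWalk, blockSlot, Sum.elim_inr, Fin.val_succ, slotCount_block rfl hcs ha hm,
        slotCount_block rfl hct ha hm, ← hα, ← hβ]
      rw [← sub_ne_zero, ← Finset.sum_sub_distrib, Finset.sum_eq_single i]
      · simpa [blockLetter, hh, sub_eq_zero] using hi
      · intro j _ hj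
        by_cases hαβ : α j = β j
        · simp [hαβ]
        · have : code j a ≠ code i a := fun h => hj (hiso j (by simpa using hαβ) h)
          simp [blockLetter, hh, this]
      · simp
  choose! co hco using hletter
  have hcard : k ≤ (Finset.range (k + 2) \ bad).card := by
    have h1 := Finset.le_card_sdiff bad (Finset.range (k + 2))
    have h2 : bad.card ≤ 2 := Finset.card_le_two
    rw [Finset.card_range] at h1
    omega
  refine hcard.trans (Finset.card_le_card_of_injOn co (fun c hc => ?_) fun c hc c' hc' h => ?_)
  · simpa using (hco c hc).2
  · rw [← (hco c hc).1, ← (hco c' hc').1, h]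

end Separation

lemma cycDist_le_of_eq_add {N : ℕ} [NeZero N] {i j : ZMod N} {δ : ℕ} (h : j = i + δ) :
    cycDist i j ≤ δ := by
  refine (min_le_left _ _).trans ?_
  rw [h, add_sub_cancel_left, ZMod.val_natCast]
  exact Nat.mod_le _ _

lemma cycDist_comm {N : ℕ} (i j : ZMod N) : cycDist i j = cycDist j i := min_comm _ _

lemma exists_isCircuitCode {d k p D n : ℕ} (hk : 1 ≤ k) (hp : p.Prime) (hkD : k * D < p)
    (hn : n + 1 ≤ 2 ^ D) (hd : n + 1 + (k + 2) * p * p = d) :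
    ∃ N, 2 ^ (n + 1) ≤ N ∧ ∃ x : ZMod N → (Fin d → Bool), IsCircuitCode d k N x := by
  have : Fact p.Prime := ⟨hp⟩
  obtain ⟨x, dir, hx, hper, hinj⟩ := exists_gray_cycle n
  obtain ⟨code, hcode⟩ := exists_isolating_code k D (n + 1) p hkD hn
  set M := (k + 2) * p with hM
  set N := (M + 1) * 2 ^ (n + 1) with hN
  have hMp : k ≤ M ∧ 3 ≤ M := ⟨by nlinarith [hp.two_le], by nlinarith [hp.two_le]⟩
  have hWN : 2 ^ (n + 1) ≤ N := Nat.le_mul_of_pos_left _ M.succ_pos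
  have hMN : M + 1 ≤ N := Nat.le_mul_of_pos_right _ (by positivity)
  have : NeZero N := ⟨by omega⟩
  set g := blockLetter fun (m : Fin M) i => code i (m : ℕ)
  have hg : ∀ φ i, blockSlot (g φ i) = φ := blockSlot_blockLetter _
  set y := slotWalk blockSlot g x with hy
  have hyper : Function.Periodic y N := slotWalk_periodic hper
  have hymod : ∀ {s t : ℕ}, (s : ZMod N) = t → y s = y t := by
    intro s t h
    rw [← hyper.map_mod_nat s, ← hyper.map_mod_nat t, (ZMod.natCast_eq_natCast_iff' _ _ _).1 h]
  have hshift : ∀ i j : ZMod N, ∀ δ ≤ M, j = i + δ →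
      cycDist i j ≤ hammingDist (y i.val) (y j.val) := by
    intro i j δ hδ h
    rw [hymod (s := j.val) (t := i.val + δ) (by simp [h])]
    exact (cycDist_le_of_eq_add h).trans (le_hammingDist_slotWalk hg hx _ (by omega))
  have hdist : ∀ i j : ZMod N, min (cycDist i j) k ≤ hammingDist (y i.val) (y j.val) := by
    intro i j
    by_cases hlt : hammingDist (y i.val) (y j.val) < k
    · obtain ⟨φ, hφ⟩ := exists_slotCount_eq_of_hammingDist_lt hcode hx _ _ hlt
      rw [← hper.map_mod_nat, ← hper.map_mod_nat (slotCount _ _ j.val)] at hφ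
      have hmod := hinj (Nat.mod_lt _ (by positivity)) (Nat.mod_lt _ (by positivity)) hφ
      obtain ⟨δ, hδ, h | h⟩ := exists_shift_of_slotCount_modEq hmod
      · have h' := (ZMod.natCast_eq_natCast_iff _ _ N).2 h
        simp only [Nat.cast_add, ZMod.natCast_zmod_val] at h'
        exact (min_le_left _ _).trans (hshift i j δ hδ h'.symm)
      · have h' := (ZMod.natCast_eq_natCast_iff _ _ N).2 h
        simp only [Nat.cast_add, ZMod.natCast_zmod_val] at h'
        rw [cycDist_comm, hammingDist_comm]
        exact (min_le_left _ _).trans (hshift j i δ hδ h'.symm)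
    · exact (min_le_right _ _).trans (not_lt.1 hlt)
  have hcard : Fintype.card (Fin d) = Fintype.card (Fin (n + 1) ⊕ (Fin M × ZMod p)) := by
    simp [ZMod.card, ← hd]
  obtain e := Fintype.equivOfCardEq hcard
  obtain b : ZMod 2 ≃ Bool := Fintype.equivOfCardEq (by simp)
  have htransfer : ∀ u v : Fin (n + 1) ⊕ (Fin M × ZMod p) → ZMod 2,
      hammingDist (fun c => b (u (e c))) (fun c => b (v (e c))) = hammingDist u v := by
    intro u v
    exact Finset.card_bijective e e.bijective (by simp)
  refine ⟨N, hWN, fun i c => b (y i.val (e c)), by omega, ?_, ?_, ?_⟩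
  · intro i j h
    have h0 : hammingDist (y i.val) (y j.val) = 0 := by
      rw [← htransfer]
      exact hammingDist_eq_zero.2 h
    have h1 := hdist i j
    have h2 : (j - i).val = 0 ∨ (i - j).val = 0 := by
      unfold cycDist at h1
      omega
    simp only [ZMod.val_eq_zero, sub_eq_zero] at h2
    exact h2.elim Eq.symm id
  · intro i
    rw [htransfer, hymod (s := (i + 1).val) (t := i.val + 1) (by simp)]
    exact hammingDist_slotWalk_succ hg hx _
  · intro i j
    rw [htransfer]
    exact hdist i j

lemma IsCircuitCode.length_le {d k N : ℕ} {x : ZMod N → (Fin d → Bool)}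
    (hx : IsCircuitCode d k N x) : N ≤ 2 ^ d := by
  have : NeZero N := ⟨by have := hx.1; omega⟩
  simpa [ZMod.card] using Fintype.card_le_of_injective x hx.2.1

lemma K_le_two_pow (d k : ℕ) : K d k ≤ 2 ^ d :=
  csSup_le' fun _ ⟨_, hx⟩ => hx.length_le

lemma IsCircuitCode.le_K {d k N : ℕ} {x : ZMod N → (Fin d → Bool)}
    (hx : IsCircuitCode d k N x) : N ≤ K d k :=
  le_csSup ⟨2 ^ d, fun _ ⟨_, h⟩ => h.length_le⟩ ⟨x, hx⟩

/-- For every integer `k ≥ 1` there exist a constant `C > 0` and an integer `D`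
such that for all `d ≥ D`, `2^(d − C·(log₂ d)²) ≤ K(d,k) ≤ 2^d`;
i.e. `log₂ K(d,k) = d + O(log² d)` as `d → ∞`. -/
theorem stmt_0 (k : ℕ) (hk : 1 ≤ k) :
    ∃ C : ℝ, 0 < C ∧ ∃ D : ℕ, ∀ d : ℕ, D ≤ d →
      (2 : ℝ) ^ ((d : ℝ) - C * (Real.logb 2 d) ^ 2) ≤ (K d k : ℝ) ∧
      K d k ≤ 2 ^ d := by
  set C : ℝ := (k + 2) * (16 * k ^ 2) with hC
  have hCpos : 0 < C := by positivity
  have hev : ∀ᶠ d : ℕ in Filter.atTop, C * (Real.logb 2 d) ^ 2 < d := by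
    have hlog : 0 < Real.log 2 := Real.log_pos one_lt_two
    have h := (Real.isLittleO_pow_log_id_atTop (n := 2)).bound
      (c := Real.log 2 ^ 2 / (2 * C)) (by positivity)
    filter_upwards [tendsto_natCast_atTop_atTop.eventually h, Filter.eventually_gt_atTop 0]
      with d hd hpos
    have hd0 : (0 : ℝ) < d := by exact_mod_cast hpos
    rw [Real.norm_of_nonneg (by positivity), id, Real.norm_of_nonneg hd0.le] at hd
    rw [Real.logb, div_pow]
    calc C * (Real.log d ^ 2 / Real.log 2 ^ 2)
        ≤ C * ((Real.log 2 ^ 2 / (2 * C) * d) / Real.log 2 ^ 2) := by gcongr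
      _ = (d : ℝ) / 2 := by
          have := hCpos.ne'
          field_simp
      _ < (d : ℝ) := by linarith
  obtain ⟨D, hD⟩ := Filter.eventually_atTop.1 hev
  refine ⟨C, hCpos, max D 2, fun d hd => ⟨?_, K_le_two_pow d k⟩⟩
  have hd2 : 2 ≤ d := (le_max_right _ _).trans hd
  have hdlt := hD d ((le_max_left _ _).trans hd)
  set L := Nat.log 2 d with hL
  have hL1 : 1 ≤ L := Nat.log_pos one_lt_two hd2
  have hdL : d < 2 ^ (L + 1) := Nat.lt_pow_succ_log_self one_lt_two d
  have hLlog : (L : ℝ) ≤ Real.logb 2 d := by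
    rw [Real.le_logb_iff_rpow_le one_lt_two (by positivity), Real.rpow_natCast]
    exact_mod_cast Nat.pow_log_le_self 2 (by omega)
  obtain ⟨p, hp, hlt, hle⟩ := Nat.exists_prime_lt_and_le_two_mul (k * (L + 1)) (by positivity)
  have hpk : p ≤ 4 * k * L := by nlinarith
  have hpC : (((k + 2) * p * p : ℕ) : ℝ) ≤ C * (Real.logb 2 d) ^ 2 := by
    have hpk' : (p : ℝ) ≤ 4 * k * Real.logb 2 d :=
      (by exact_mod_cast hpk : (p : ℝ) ≤ 4 * k * L).trans (by gcongr)
    calc (((k + 2) * p * p : ℕ) : ℝ) = (k + 2) * (p : ℝ) ^ 2 := by push_cast; ring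
      _ ≤ (k + 2) * (4 * k * Real.logb 2 d) ^ 2 := by gcongr
      _ = C * (Real.logb 2 d) ^ 2 := by rw [hC]; ring
  have hpd : (k + 2) * p * p < d := by exact_mod_cast hpC.trans_lt hdlt
  obtain ⟨n, hn⟩ : ∃ n, n + 1 + (k + 2) * p * p = d :=
    ⟨d - (k + 2) * p * p - 1, by omega⟩
  obtain ⟨N, hN, x, hx⟩ := exists_isCircuitCode hk hp hlt (by omega) hn
  calc (2 : ℝ) ^ ((d : ℝ) - C * (Real.logb 2 d) ^ 2) ≤ 2 ^ ((n + 1 : ℕ) : ℝ) := by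
        refine Real.rpow_le_rpow_of_exponent_le one_le_two ?_
        have : (d : ℝ) = (n + 1 : ℕ) + ((k + 2) * p * p : ℕ) := by exact_mod_cast hn.symm
        linarith
    _ = ((2 ^ (n + 1) : ℕ) : ℝ) := by rw [Real.rpow_natCast]; push_cast; rfl
    _ ≤ (K d k : ℝ) := by exact_mod_cast hN.trans hx.le_K
end

section
/- Let k ≥ 2, d ≥ (k+2)², and s be integers with k ≤ s ≤ d. Then K(d+1,k,s) ≥ K(d,k); that is, there exists a (d+1,k) circuit code whose length is divisible by s and is at least K(d,k). -/
/-- `Kdiv d k s`: the maximum length of a `(d,k)` circuit code whose length is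
divisible by `s`. -/
noncomputable def Kdiv (d k s : ℕ) : ℕ :=
  sSup {N | s ∣ N ∧ ∃ x : ZMod N → (Fin d → Bool), IsCircuitCode d k N x}

/-- A circuit code traversed by a natural number index `0, …, N`, returning to its start at `N`. -/
def IsClosedCode (d k N : ℕ) (y : ℕ → Fin d → Bool) : Prop :=
  3 ≤ N ∧ y N = y 0 ∧ (∀ n < N, hammingDist (y n) (y (n + 1)) = 1) ∧
    ∀ a b, a ≤ b → b ≤ N → min (min (b - a) (N - (b - a))) k ≤ hammingDist (y a) (y b)

lemma cycDist_natCast {N a b : ℕ} (hab : a ≤ b) (hb : b ≤ N) :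
    cycDist (a : ZMod N) (b : ZMod N) = min (b - a) (N - (b - a)) := by
  have h₁ : (b : ZMod N) - a = ((b - a : ℕ) : ZMod N) := by push_cast [hab]; ring
  have h₂ : (a : ZMod N) - b = ((N - (b - a) : ℕ) : ZMod N) := by
    rw [Nat.cast_sub (by omega), Nat.cast_sub hab, ZMod.natCast_self]; ring
  rw [cycDist, h₁, h₂, ZMod.val_natCast, ZMod.val_natCast]
  rcases Nat.eq_zero_or_pos (b - a) with h | h
  · simp [h]
  rcases Nat.lt_or_ge (b - a) N with h' | h'
  · rw [Nat.mod_eq_of_lt h', Nat.mod_eq_of_lt (by omega)]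
  · have : b - a = N := by omega
    simp [this]

lemma IsCircuitCode.isClosedCode {d k N : ℕ} {x : ZMod N → Fin d → Bool}
    (h : IsCircuitCode d k N x) : IsClosedCode d k N (fun n => x n) := by
  obtain ⟨hN, -, hstep, hdist⟩ := h
  refine ⟨hN, by simp, fun n _ => by simpa using hstep n, fun a b hab hb => ?_⟩
  rw [← cycDist_natCast hab hb]
  exact hdist a b

lemma IsClosedCode.isCircuitCode {d k N : ℕ} {y : ℕ → Fin d → Bool} (hk : 1 ≤ k)
    (h : IsClosedCode d k N y) : IsCircuitCode d k N (fun i => y i.val) := by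
  obtain ⟨hN, hclosed, hstep, hdist⟩ := h
  have : NeZero N := ⟨by omega⟩
  have key : ∀ i j : ZMod N, min (cycDist i j) k ≤ hammingDist (y i.val) (y j.val) := by
    intro i j
    wlog hij : i.val ≤ j.val generalizing i j
    · rw [cycDist_comm, hammingDist_comm]
      exact this j i (by omega)
    have := hdist i.val j.val hij j.val_lt.le
    rwa [← cycDist_natCast hij j.val_lt.le, ZMod.natCast_zmod_val,
      ZMod.natCast_zmod_val] at this
  refine ⟨hN, fun i j hij => ?_, fun i => ?_, key⟩
  · have h0 := key i j
    rw [show y i.val = y j.val from hij, hammingDist_self] at h0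
    have h1 : (j - i).val = 0 ∨ (i - j).val = 0 := by
      unfold cycDist at h0
      omega
    rcases h1 with h1 | h1
    · exact (sub_eq_zero.mp ((ZMod.val_eq_zero _).mp h1)).symm
    · exact sub_eq_zero.mp ((ZMod.val_eq_zero _).mp h1)
  · have hi := hstep i.val i.val_lt
    have hval : (i + 1).val = (i.val + 1) % N := by
      rw [← ZMod.val_natCast]; simp
    show hammingDist (y i.val) (y (i + 1).val) = 1
    rw [hval]
    rcases Nat.lt_or_ge (i.val + 1) N with h' | h'
    · rwa [Nat.mod_eq_of_lt h']
    · have h'' : i.val + 1 = N := by have := i.val_lt; omega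
      rw [h'', hclosed] at hi
      rwa [h'', Nat.mod_self]

lemma hammingDist_cons {d : ℕ} (a b : Bool) (u v : Fin d → Bool) :
    hammingDist (Fin.cons a u : Fin (d + 1) → Bool) (Fin.cons b v : Fin (d + 1) → Bool) =
      (if a ≠ b then 1 else 0) + hammingDist u v := by
  simp only [hammingDist, Finset.card_filter, Fin.sum_univ_succ, Fin.cons_zero, Fin.cons_succ]

/-- Splitting a walk of length `n` into blocks of `k + 1` steps, at most `r` of them, gives
`q` complete blocks with the listed properties. -/
lemma min_div_block (k r n : ℕ) :
    min (n / (k + 1)) r ≤ r ∧ min (n / (k + 1)) r * k + min (n / (k + 1)) r ≤ n ∧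
      (min (n / (k + 1)) r < r →
        n < min (n / (k + 1)) r * k + min (n / (k + 1)) r + k + 1) := by
  have h₁ := Nat.div_mul_le_self n (k + 1)
  have h₂ := Nat.lt_div_mul_add (a := n) (b := k + 1) (by omega)
  refine ⟨min_le_right _ _, ?_, fun h => ?_⟩
  · have := Nat.mul_le_mul_right (k + 1) (min_le_left (n / (k + 1)) r)
    rw [mul_add, mul_one] at this
    omega
  · have : min (n / (k + 1)) r = n / (k + 1) := by omega
    rw [this]
    rw [mul_add, mul_one] at h₂
    omega

/-- Inserting `2 m` transitions in a new coordinate, any two of them separated by at least `k`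
old transitions, preserves the spread. -/
lemma IsClosedCode.insert {d k N : ℕ} {y : ℕ → Fin d → Bool} (h : IsClosedCode d k N y)
    (m : ℕ) (hm : 2 * m * k ≤ N) :
    ∃ z : ℕ → Fin (d + 1) → Bool, IsClosedCode (d + 1) k (N + 2 * m) z := by
  obtain ⟨hN, hclosed, hstep, hdist⟩ := h
  set q : ℕ → ℕ := fun n => min (n / (k + 1)) (2 * m) with hq
  have hblock : ∀ n, q n ≤ 2 * m ∧ q n * k + q n ≤ n ∧
      (q n < 2 * m → n < q n * k + q n + k + 1) := min_div_block k (2 * m)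
  have hmono : ∀ a b, a ≤ b → q a ≤ q b := fun a b hab =>
    min_le_min_right _ (Nat.div_le_div_right hab)
  have hsub : ∀ n ≤ N + 2 * m, n - q n ≤ N := by
    intro n hn
    obtain ⟨h₁, h₂, h₃⟩ := hblock n
    rcases Nat.lt_or_ge (q n) (2 * m) with hlt | hge
    · have := Nat.mul_le_mul_right k (show q n + 1 ≤ 2 * m from hlt)
      have := h₃ hlt
      rw [add_mul] at *
      omega
    · omega
  have hsucc : ∀ n, q (n + 1) = q n ∨ q (n + 1) = q n + 1 := by
    intro n
    simp only [hq, Nat.succ_div]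
    split_ifs <;> omega
  have hq0 : q 0 = 0 := by simp [hq]
  have hqN : q (N + 2 * m) = 2 * m := by
    have : 2 * m ≤ (N + 2 * m) / (k + 1) := by
      rw [Nat.le_div_iff_mul_le (by omega), mul_add, mul_one]
      omega
    simp [hq, this]
  refine ⟨fun n => Fin.cons (decide (q n % 2 = 1)) (y (n - q n)), by omega, ?_, ?_, ?_⟩
  · simp [hqN, hq0, hclosed]
  · intro n hn
    obtain ⟨-, h₂, -⟩ := hblock n
    obtain ⟨-, h₂', -⟩ := hblock (n + 1)
    rw [hammingDist_cons]
    rcases hsucc n with he | he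
    · have hn' := hsub (n + 1) (by omega)
      rw [he] at hn' ⊢
      rw [show n + 1 - q n = n - q n + 1 by omega, hstep (n - q n) (by omega)]
      simp
    · rw [he, show n + 1 - (q n + 1) = n - q n by omega, hammingDist_self, if_pos]
      by_cases hp : q n % 2 = 1
      · simp [hp, show ¬ (q n + 1) % 2 = 1 by omega]
      · simp [hp, show (q n + 1) % 2 = 1 by omega]
  · intro a b hab hb
    rw [hammingDist_cons]
    obtain ⟨ha₁, ha₂, ha₃⟩ := hblock a
    obtain ⟨hb₁, hb₂, hb₃⟩ := hblock b
    have hqab := hmono a b hab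
    have hbN := hsub b hb
    have hle : a - q a ≤ b - q b := by
      clear_value q
      rcases hqab.lt_or_eq with hlt | heq
      · have := ha₃ (by omega)
        have := Nat.mul_le_mul_right k (show q a + 1 ≤ q b from hlt)
        rw [add_mul] at this
        omega
      · omega
    have hd := hdist (a - q a) (b - q b) hle hbN
    have hpar : (if decide (q a % 2 = 1) ≠ decide (q b % 2 = 1) then 1 else 0)
        = (q b - q a) % 2 := by
      by_cases h1 : q a % 2 = 1 <;> by_cases h2 : q b % 2 = 1 <;> simp [h1, h2] <;> omega
    rw [hpar]
    have hinner : q a + 2 ≤ q b → k ≤ (b - q b) - (a - q a) := by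
      intro hlt
      have := ha₃ (by omega)
      have := Nat.mul_le_mul_right k hlt
      rw [add_mul] at this
      omega
    have houter : q b + 2 ≤ 2 * m + q a → k ≤ N - ((b - q b) - (a - q a)) := by
      intro hlt
      rcases Nat.lt_or_ge (q b) (2 * m) with hlt' | hge
      · have := hb₃ hlt'
        have := Nat.mul_le_mul_right k hlt
        simp only [add_mul] at this
        omega
      · have := Nat.mul_le_mul_right k (show 1 ≤ q a by omega)
        omega
    clear_value q
    omega

lemma hammingDist_le_of_steps {d N : ℕ} {y : ℕ → Fin d → Bool}
    (hstep : ∀ n < N, hammingDist (y n) (y (n + 1)) = 1) {a b : ℕ} (hab : a ≤ b) (hb : b ≤ N) :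
    hammingDist (y a) (y b) ≤ b - a := by
  induction b, hab using Nat.le_induction with
  | base => simp
  | succ b hab ih =>
    have h₁ := hammingDist_triangle (y a) (y b) (y (b + 1))
    have h₂ := ih (by omega)
    have h₃ := hstep b (by omega)
    omega

/-- The circuit of length `2 k` in dimension `k` running through all coordinates twice. -/
lemma exists_isClosedCode_two_mul {k : ℕ} (hk : 2 ≤ k) :
    ∃ y : ℕ → Fin k → Bool, IsClosedCode k k (2 * k) y := by
  set y : ℕ → Fin k → Bool := fun n c => decide (c.val < n ∧ n ≤ c.val + k) with hy
  have hstep : ∀ n < 2 * k, hammingDist (y n) (y (n + 1)) = 1 := by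
    intro n hn
    rw [hammingDist, Finset.card_eq_one]
    refine ⟨⟨if n < k then n else n - k, by split_ifs <;> omega⟩, ?_⟩
    ext c
    have := c.isLt
    simp only [hy, Finset.mem_filter, Finset.mem_univ, true_and, Finset.mem_singleton, Fin.ext_iff,
      ne_eq, decide_eq_decide]
    split_ifs <;> omega
  have hanti : ∀ n ≤ k, hammingDist (y n) (y (n + k)) = k := by
    intro n hn
    rw [hammingDist, Finset.filter_true_of_mem, Finset.card_univ, Fintype.card_fin]
    intro c _
    have := c.isLt
    simp only [hy, ne_eq, decide_eq_decide]
    omega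
  refine ⟨y, by omega, ?_, hstep, fun a b hab hb => ?_⟩
  · funext c
    have := c.isLt
    simp only [hy, decide_eq_decide]
    omega
  · rcases Nat.lt_or_ge b k with hbk | hbk
    · have h₁ := hanti a (by omega)
      have h₂ := hammingDist_triangle (y a) (y b) (y (a + k))
      have h₃ := hammingDist_le_of_steps hstep (a := b) (b := a + k) (by omega) (by omega)
      omega
    · have h₁ := hanti (b - k) (by omega)
      rw [Nat.sub_add_cancel hbk] at h₁
      have h₂ := hammingDist_triangle (y (b - k)) (y a) (y b)
      rcases le_total a (b - k) with h | h
      · have h₃ := hammingDist_le_of_steps hstep h (by omega)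
        rw [hammingDist_comm] at h₃
        omega
      · have h₃ := hammingDist_le_of_steps hstep h (by omega)
        omega

lemma exists_isClosedCode_add {d k t N : ℕ} (hN : 2 * t * k ≤ N) {y : ℕ → Fin d → Bool}
    (h : IsClosedCode d k N y) (j : ℕ) :
    ∃ z : ℕ → Fin (d + j) → Bool, IsClosedCode (d + j) k (N + 2 * t * j) z := by
  induction j with
  | zero => exact ⟨y, h⟩
  | succ j ih =>
    obtain ⟨z, hz⟩ := ih
    obtain ⟨w, hw⟩ := hz.insert t (by omega)
    exact ⟨w, by rwa [mul_add, mul_one, ← add_assoc N]⟩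

lemma exists_isClosedCode_pow {k : ℕ} (hk : 2 ≤ k) (p : ℕ) :
    ∃ y : ℕ → Fin (k * (p + 1)) → Bool, IsClosedCode (k * (p + 1)) k (2 * 2 ^ p * k) y := by
  induction p with
  | zero =>
    rw [zero_add, mul_one, pow_zero, mul_one]
    exact exists_isClosedCode_two_mul hk
  | succ p ih =>
    obtain ⟨y, hy⟩ := ih
    obtain ⟨z, hz⟩ := exists_isClosedCode_add le_rfl hy k
    rw [show k * (p + 1 + 1) = k * (p + 1) + k by ring,
      show 2 * 2 ^ (p + 1) * k = 2 * 2 ^ p * k + 2 * 2 ^ p * k by ring]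
    exact ⟨z, hz⟩

lemma add_two_sq_lt_two_pow (k : ℕ) : (k + 2) ^ 2 < 2 ^ (k + 3) := by
  induction k with
  | zero => norm_num
  | succ k ih =>
    rw [show 2 ^ (k + 1 + 3) = 2 * 2 ^ (k + 3) by ring]
    have : (k + 1 + 2) ^ 2 + (k ^ 2 + 2 * k + 1) = 2 * ((k + 2) ^ 2 + 1) := by ring
    omega

lemma exists_long_isClosedCode {k d : ℕ} (hk : 2 ≤ k) (hd : (k + 2) ^ 2 ≤ d) :
    ∃ N, 2 * d * k ≤ N ∧ ∃ y : ℕ → Fin d → Bool, IsClosedCode d k N y := by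
  induction d, hd using Nat.le_induction with
  | base =>
    obtain ⟨y, hy⟩ := exists_isClosedCode_pow hk (k + 3)
    have h4 := exists_isClosedCode_add (t := 0) (by simp) hy 4
    refine ⟨2 * 2 ^ (k + 3) * k, ?_, ?_⟩
    · exact Nat.mul_le_mul_right k (Nat.mul_le_mul_left 2 (add_two_sq_lt_two_pow k).le)
    · rw [show (k + 2) ^ 2 = k * (k + 3 + 1) + 4 by ring]
      simpa using h4
  | succ d hd ih =>
    obtain ⟨N, hN, y, hy⟩ := ih
    refine ⟨N + 2 * d, ?_, hy.insert d hN⟩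
    nlinarith

lemma natCast_hammingDist {d : ℕ} (u v : Fin d → Bool) :
    (hammingDist u v : ZMod 2) = ∑ c, ((v c).toNat : ZMod 2) - ∑ c, ((u c).toNat : ZMod 2) := by
  rw [hammingDist, Finset.card_filter, ← Finset.sum_sub_distrib, Nat.cast_sum]
  refine Finset.sum_congr rfl fun c _ => ?_
  cases u c <;> cases v c <;> decide

lemma IsCircuitCode.even {d k N : ℕ} {x : ZMod N → Fin d → Bool} (h : IsCircuitCode d k N x) :
    Even N := by
  obtain ⟨hN, -, hstep, -⟩ := h
  have : NeZero N := ⟨by omega⟩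
  have hsum : ∑ i : ZMod N, (hammingDist (x i) (x (i + 1)) : ZMod 2) = 0 := by
    simp only [natCast_hammingDist, Finset.sum_sub_distrib]
    rw [sub_eq_zero]
    exact Equiv.sum_comp (Equiv.addRight (1 : ZMod N)) fun i => ∑ c, ((x i c).toNat : ZMod 2)
  simp only [hstep, Nat.cast_one, Finset.sum_const, Finset.card_univ, ZMod.card, nsmul_eq_mul,
    mul_one] at hsum
  exact (ZMod.natCast_eq_zero_iff_even).mp hsum

lemma IsCircuitCode.le_two_pow {d k N : ℕ} {x : ZMod N → Fin d → Bool}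
    (h : IsCircuitCode d k N x) : N ≤ 2 ^ d := by
  have : NeZero N := ⟨by have := h.1; omega⟩
  simpa using Fintype.card_le_of_injective x h.2.1

lemma Even.exists_dvd_add_two_mul {N s : ℕ} (hN : Even N) (hs : 0 < s) :
    ∃ m < s, s ∣ N + 2 * m := by
  obtain ⟨n, rfl⟩ := hN
  have := Nat.mod_lt n hs
  have hdiv := Nat.div_add_mod n s
  rcases Nat.eq_zero_or_pos (n % s) with h0 | h0
  · exact ⟨0, hs, 2 * (n / s), by linarith⟩
  · exact ⟨s - n % s, by omega, 2 * (n / s + 1), by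
      rw [show s * (2 * (n / s + 1)) = 2 * (s * (n / s)) + 2 * s by ring]; omega⟩

/-- For `k ≥ 2`, `d ≥ (k+2)²` and `k ≤ s ≤ d`, one has `K(d+1,k,s) ≥ K(d,k)`:
there is a `(d+1,k)` circuit code whose length is divisible by `s` and is at
least `K(d,k)`. -/
theorem stmt_3 (k d s : ℕ) (hk : 2 ≤ k) (hd : (k + 2) ^ 2 ≤ d)
    (hs₁ : k ≤ s) (hs₂ : s ≤ d) :
    K d k ≤ Kdiv (d + 1) k s ∧
    ∃ N : ℕ, s ∣ N ∧ K d k ≤ N ∧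
      ∃ x : ZMod N → (Fin (d + 1) → Bool), IsCircuitCode (d + 1) k N x := by
  have hbdd : BddAbove {N | ∃ x : ZMod N → (Fin d → Bool), IsCircuitCode d k N x} :=
    ⟨2 ^ d, fun N ⟨_, hx⟩ => hx.le_two_pow⟩
  obtain ⟨L, hL, y, hy⟩ := exists_long_isClosedCode hk hd
  have hLmem : L ∈ {N | ∃ x : ZMod N → (Fin d → Bool), IsCircuitCode d k N x} :=
    ⟨_, hy.isCircuitCode (by omega)⟩
  obtain ⟨x, hx⟩ : K d k ∈ {N | ∃ x : ZMod N → (Fin d → Bool), IsCircuitCode d k N x} :=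
    Nat.sSup_mem ⟨L, hLmem⟩ hbdd
  have hLK : L ≤ K d k := le_csSup hbdd hLmem
  obtain ⟨m, hm, hdvd⟩ := hx.even.exists_dvd_add_two_mul (s := s) (by omega)
  have hmk : 2 * m * k ≤ K d k := calc
    2 * m * k ≤ 2 * d * k := by gcongr; omega
    _ ≤ K d k := hL.trans hLK
  obtain ⟨z, hz⟩ := hx.isClosedCode.insert m hmk
  have hz' := hz.isCircuitCode (by omega)
  refine ⟨?_, K d k + 2 * m, hdvd, by omega, _, hz'⟩
  exact (Nat.le_add_right _ (2 * m)).trans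
    (le_csSup ⟨2 ^ (d + 1), fun N ⟨_, _, hx⟩ => hx.le_two_pow⟩ ⟨hdvd, _, hz'⟩)
end

section
/- Let k ≥ 2 be an even integer and let m, n be integers with (k+2)² ≤ m ≤ n. Then k·K(m+n+2,k) ≥ K(m,k−1)·K(n,k). -/
/-! ### Circuit codes as periodic sequences -/

/-- A circuit code of spread `k` and length `N`, viewed as an `N`-periodic bi-infinite walk in the
hypercube with coordinates indexed by `ι`. -/
structure IsPeriodicCode {ι : Type*} [Fintype ι] (k N : ℤ) (X : ℤ → ι → Bool) : Prop where
  periodic : ∀ i, X (i + N) = X i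
  step : ∀ i, hammingDist (X i) (X (i + 1)) = 1
  spread : ∀ i t, 0 ≤ t → t ≤ N → min k (min t (N - t)) ≤ hammingDist (X i) (X (i + t))

section Hamming

variable {ι κ : Type*} [Fintype ι] [Fintype κ]

theorem hammingDist_sumElim (a a' : ι → Bool) (b b' : κ → Bool) :
    hammingDist (Sum.elim a b) (Sum.elim a' b') = hammingDist a a' + hammingDist b b' := by
  simp only [hammingDist, Finset.card_filter, Fintype.sum_sum_type, Sum.elim_inl, Sum.elim_inr]
  congr

theorem hammingDist_comp_equiv (e : ι ≃ κ) (a b : κ → Bool) :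
    hammingDist (a ∘ e) (b ∘ e) = hammingDist a b := by
  simp only [hammingDist, Finset.card_filter, Function.comp]
  exact Equiv.sum_comp e fun i => if a i ≠ b i then 1 else 0

theorem hammingDist_pair (a b c d : Bool) :
    hammingDist ![a, b] ![c, d] = (if a = c then 0 else 1) + (if b = d then 0 else 1) := by
  revert a b c d; decide

theorem exists_update_of_hammingDist_eq_one [DecidableEq ι] {a b : ι → Bool}
    (h : hammingDist a b = 1) : ∃ c, b = Function.update a c (!a c) := by
  obtain ⟨c, hc⟩ := Finset.card_eq_one.1 h
  refine ⟨c, funext fun j => ?_⟩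
  have hj := Finset.ext_iff.1 hc j
  simp only [Finset.mem_filter, Finset.mem_univ, true_and, Finset.mem_singleton] at hj
  by_cases hjc : j = c
  · subst hjc
    have := hj.2 rfl
    simp only [Function.update_self]
    cases h1 : a j <;> cases h2 : b j <;> simp_all
  · rw [Function.update_of_ne hjc]
    by_contra hne
    exact hjc (hj.1 fun h => hne h.symm)

theorem hammingDist_update_not [DecidableEq ι] {a b : ι → Bool} {c : ι} (h : a c = b c) :
    hammingDist a (Function.update b c (!b c)) = hammingDist a b + 1 := by
  have hs : (Finset.univ.filter fun i => a i ≠ Function.update b c (!b c) i)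
      = insert c (Finset.univ.filter fun i => a i ≠ b i) := by
    ext j
    simp only [Finset.mem_filter, Finset.mem_univ, true_and, Finset.mem_insert]
    by_cases hj : j = c
    · subst hj; simp [h]
    · simp [hj]
  unfold hammingDist
  rw [hs, Finset.card_insert_of_notMem (by simp [h])]

theorem hammingDist_not_right (a : ι → Bool) :
    hammingDist a (fun j => !a j) = Fintype.card ι := by
  simp [hammingDist]

/-- In a hypercube, walking along an edge changes the parity of the distance to any vertex. -/
theorem even_hammingDist_step {a b c : ι → Bool} (h : hammingDist b c = 1) :
    Even (hammingDist a c) ↔ ¬ Even (hammingDist a b) := by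
  classical
  obtain ⟨j, rfl⟩ := exists_update_of_hammingDist_eq_one h
  by_cases hj : a j = b j
  · rw [hammingDist_update_not hj, Nat.even_add_one]
  · have h1 : b = Function.update (Function.update b j (!b j)) j
        (!(Function.update b j (!b j)) j) := by
      rw [Function.update_self, Function.update_idem, Bool.not_not, Function.update_eq_self]
    have h2 : hammingDist a b = hammingDist a (Function.update b j (!b j)) + 1 := by
      have h3 := hammingDist_update_not (a := a) (b := Function.update b j (!b j)) (c := j)
      rw [← h1] at h3
      apply h3
      rw [Function.update_self]
      exact Bool.eq_not.2 hj
    rw [h2, Nat.even_add_one, not_not]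

variable {X : ℤ → ι → Bool}

theorem hammingDist_walk_le (h : ∀ i, hammingDist (X i) (X (i + 1)) = 1) (i : ℤ) (t : ℕ) :
    hammingDist (X i) (X (i + t)) ≤ t := by
  induction t with
  | zero => simp
  | succ t ih =>
    have := hammingDist_triangle (X i) (X (i + t)) (X (i + t + 1))
    rw [h] at this
    push_cast
    rw [← add_assoc]
    omega

theorem even_hammingDist_walk (h : ∀ i, hammingDist (X i) (X (i + 1)) = 1) (i : ℤ) (t : ℕ) :
    Even (hammingDist (X i) (X (i + t))) ↔ Even t := by
  induction t with
  | zero => simp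
  | succ t ih =>
    push_cast
    rw [← add_assoc, even_hammingDist_step (h (i + t)), ih, Nat.even_add_one]

end Hamming

namespace IsPeriodicCode

variable {ι : Type*} [Fintype ι] {k N : ℤ} {X : ℤ → ι → Bool}

theorem add_mul (hX : IsPeriodicCode k N X) (i c : ℤ) : X (i + c * N) = X i := by
  have := (show Function.Periodic X N from hX.periodic).int_mul c i
  simpa using this

theorem congr (hX : IsPeriodicCode k N X) {i j : ℤ} (h : N ∣ j - i) : X j = X i := by
  obtain ⟨c, hc⟩ := h
  rw [show j = i + c * N by linarith, hX.add_mul]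

theorem even_dist (hX : IsPeriodicCode k N X) {i j : ℤ} (hij : i ≤ j) :
    Even (hammingDist (X i) (X j)) ↔ Even (j - i) := by
  obtain ⟨t, rfl⟩ := Int.le.dest hij
  rw [even_hammingDist_walk hX.step]
  simp [Int.even_coe_nat]

theorem even_period (hX : IsPeriodicCode k N X) (hN : 0 ≤ N) : Even N := by
  have h := hX.even_dist (show (0 : ℤ) ≤ 0 + N by omega)
  rw [hX.periodic] at h
  simpa using h

theorem spread' (hX : IsPeriodicCode k N X) {i j : ℤ} (hij : i ≤ j) (hj : j ≤ i + N) :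
    min k (min (j - i) (N - (j - i))) ≤ hammingDist (X i) (X j) := by
  have := hX.spread i (j - i) (by omega) (by omega)
  rwa [add_sub_cancel] at this

theorem one_le_dist (hX : IsPeriodicCode k N X) (hk : 1 ≤ k) (hN : 0 < N) {i j : ℤ}
    (h : ¬ N ∣ j - i) : 1 ≤ hammingDist (X i) (X j) := by
  have h1 := hX.spread i ((j - i) % N) (Int.emod_nonneg _ hN.ne') (Int.emod_lt_of_pos _ hN).le
  have h2 : X (i + (j - i) % N) = X j := hX.congr ⟨-((j - i) / N), by
    have := Int.emod_add_mul_ediv (j - i) N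
    linarith⟩
  rw [h2] at h1
  have h3 : (j - i) % N ≠ 0 := fun h0 => h (Int.dvd_of_emod_eq_zero h0)
  have h4 := Int.emod_nonneg (j - i) hN.ne'
  have h5 := Int.emod_lt_of_pos (j - i) hN
  omega

end IsPeriodicCode

theorem IsCircuitCode.isPeriodicCode {d k N : ℕ} {x : ZMod N → Fin d → Bool}
    (hx : IsCircuitCode d k N x) : IsPeriodicCode k N fun i : ℤ => x i := by
  obtain ⟨hN, -, hs, hd⟩ := hx
  have : NeZero N := ⟨by omega⟩
  refine ⟨fun i => by simp, fun i => by simpa using hs i, fun i t h0 h1 => ?_⟩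
  by_cases ht : t = 0 ∨ t = N
  · have : min (t : ℤ) (N - t) ≤ 0 := by omega
    omega
  have h := hd i (i + t : ℤ)
  lift t to ℕ using h0
  have e1 : (((i + (t : ℤ) : ℤ) : ZMod N) - (i : ZMod N)).val = t := by
    push_cast
    rw [add_sub_cancel_left, ZMod.val_natCast, Nat.mod_eq_of_lt (by omega)]
  have e2 : ((i : ZMod N) - ((i + (t : ℤ) : ℤ) : ZMod N)).val = N - t := by
    have : (i : ZMod N) - ((i + (t : ℤ) : ℤ) : ZMod N) = ((N - t : ℕ) : ZMod N) := by
      rw [Nat.cast_sub (by omega)]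
      push_cast
      simp
    rw [this, ZMod.val_natCast, Nat.mod_eq_of_lt (by omega)]
  unfold cycDist at h
  rw [e1, e2] at h
  push_cast at h ⊢
  omega

theorem bddAbove_circuitCode_length (d k : ℕ) :
    BddAbove {N | ∃ x : ZMod N → (Fin d → Bool), IsCircuitCode d k N x} := by
  refine ⟨Fintype.card (Fin d → Bool), ?_⟩
  rintro N ⟨x, hN, hinj, -⟩
  have : NeZero N := ⟨by omega⟩
  simpa using Fintype.card_le_of_injective x hinj

theorem IsPeriodicCode.le_K {ι : Type*} [Fintype ι] {d k N : ℕ} {X : ℤ → ι → Bool}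
    (hX : IsPeriodicCode k N X) (hd : Fintype.card ι = d) (hk : 1 ≤ k) (hN : 3 ≤ N) :
    N ≤ K d k := by
  have : NeZero N := ⟨by omega⟩
  let e : Fin d ≃ ι := (Fintype.equivFinOfCardEq hd).symm
  have key : ∀ i j : ZMod N, X (i.val + (j - i).val) = X j.val := fun i j => hX.congr (by
    rw [← ZMod.intCast_zmod_eq_zero_iff_dvd]
    simp)
  refine le_csSup (bddAbove_circuitCode_length d k) ⟨fun z => X z.val ∘ e, hN, ?_, ?_, ?_⟩
  · intro i j hij
    by_contra hne
    have h1 := hX.one_le_dist (by omega) (by omega) (i := i.val) (j := j.val) (by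
      rw [← ZMod.intCast_zmod_eq_zero_iff_dvd]
      simpa [sub_eq_zero] using fun h => hne h.symm)
    rw [← hammingDist_comp_equiv e, show X i.val ∘ e = X j.val ∘ e from hij] at h1
    simp at h1
  · intro i
    simp only
    rw [hammingDist_comp_equiv, ← hX.step i.val]
    congr 1
    refine hX.congr ?_
    rw [← ZMod.intCast_zmod_eq_zero_iff_dvd]
    simp
  · intro i j
    simp only
    rw [hammingDist_comp_equiv]
    have h1 := hX.spread i.val (j - i).val (by omega) (by exact_mod_cast (ZMod.val_lt _).le)
    rw [key] at h1
    have h2 : (i - j).val ≤ N - (j - i).val := by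
      rw [← neg_sub j i, ZMod.neg_val]
      split_ifs <;> omega
    have h3 := ZMod.val_lt (j - i)
    unfold cycDist
    omega

theorem exists_isPeriodicCode_K {d k : ℕ} (h : 3 ≤ K d k) :
    ∃ X : ℤ → Fin d → Bool, IsPeriodicCode k (K d k) X := by
  have hne : {N | ∃ x : ZMod N → (Fin d → Bool), IsCircuitCode d k N x}.Nonempty := by
    by_contra hc
    rw [Set.not_nonempty_iff_eq_empty] at hc
    simp [K, hc] at h
  obtain ⟨x, hx⟩ := Nat.sSup_mem hne (bddAbove_circuitCode_length d k)
  exact ⟨_, hx.isPeriodicCode⟩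

/-! ### The antipodal cycle of length `2d` -/

/-- The cycle of length `2d` in dimension `d` which flips the coordinates cyclically. -/
def antipodalCycle (d : ℕ) (i : ℤ) (j : Fin d) : Bool := decide (Even ((i + j) / d))

theorem antipodalCycle_add (d : ℕ) (i : ℤ) :
    antipodalCycle d (i + d) = fun j => !antipodalCycle d i j := by
  funext j
  have hd : (d : ℤ) ≠ 0 := by have := j.2; omega
  unfold antipodalCycle
  rw [show i + d + j = i + j + 1 * (d : ℤ) by ring, Int.add_mul_ediv_right _ _ hd]
  rw [← decide_not, decide_eq_decide, Int.even_add_one]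

theorem antipodalCycle_step {d : ℕ} (hd : 0 < d) (i : ℤ) :
    hammingDist (antipodalCycle d i) (antipodalCycle d (i + 1)) = 1 := by
  have hd' : (0 : ℤ) < d := by exact_mod_cast hd
  unfold hammingDist
  rw [Finset.card_eq_one]
  have h0 := Int.emod_nonneg (-(i + 1)) hd'.ne'
  have h1 := Int.emod_lt_of_pos (-(i + 1)) hd'
  refine ⟨⟨((-(i + 1)) % d).toNat, by omega⟩, ?_⟩
  ext j
  simp only [Finset.mem_filter, Finset.mem_univ, true_and, Finset.mem_singleton, Fin.ext_iff,
    antipodalCycle, ne_eq, decide_eq_decide]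
  have hj : ((j : ℕ) : ℤ) < d := by exact_mod_cast j.2
  have e1 := Int.emod_add_mul_ediv (-(i + 1)) d
  have e2 := Int.emod_add_mul_ediv (i + j) d
  have b0 := Int.emod_nonneg (i + j) hd'.ne'
  have b1 := Int.emod_lt_of_pos (i + j) hd'
  by_cases hc : (i + j) % d = d - 1
  · have h2 : (i + 1 + j) / d = (i + j) / d + 1 := by
      rw [show i + 1 + j = 0 + ((i + j) / d + 1) * (d : ℤ) by linarith,
        Int.add_mul_ediv_right _ _ hd'.ne']
      simp
    have h3 : (-(i + 1)) % d = j := by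
      rw [show -(i + 1) = j + (-((i + j) / d + 1)) * (d : ℤ) by linarith,
        Int.add_mul_emod_self_right, Int.emod_eq_of_lt (by omega) hj]
    rw [h2, h3]
    rw [Int.even_add_one]
    tauto
  · have h2 : (i + 1 + j) / d = (i + j) / d := by
      rw [show i + 1 + j = ((i + j) % d + 1) + ((i + j) / d) * (d : ℤ) by linarith,
        Int.add_mul_ediv_right _ _ hd'.ne', Int.ediv_eq_zero_of_lt (by omega) (by omega)]
      simp
    rw [h2]
    simp only [not_true_eq_false, false_iff]
    intro h3
    apply hc
    have h4 : (-(i + 1)) % d = j := by omega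
    rw [h4] at e1
    rw [show i + j = (d - 1) + (-((-(i + 1)) / d) - 1) * (d : ℤ) by linarith,
      Int.add_mul_emod_self_right, Int.emod_eq_of_lt (by omega) (by omega)]

theorem le_hammingDist_antipodalCycle {d : ℕ} (hd : 0 < d) (i : ℤ) {t : ℕ} (ht : t ≤ d) :
    t ≤ hammingDist (antipodalCycle d i) (antipodalCycle d (i + t)) := by
  have h1 := hammingDist_not_right (antipodalCycle d i)
  rw [← antipodalCycle_add, Fintype.card_fin] at h1
  have h2 := hammingDist_triangle (antipodalCycle d i) (antipodalCycle d (i + t))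
    (antipodalCycle d (i + d))
  have h3 := hammingDist_walk_le (antipodalCycle_step hd) (i + t) (d - t)
  rw [show i + (t : ℤ) + ((d - t : ℕ) : ℤ) = i + d by omega] at h3
  omega

theorem antipodalCycle_add_two_mul (d : ℕ) (i : ℤ) :
    antipodalCycle d (i + 2 * d) = antipodalCycle d i := by
  rw [two_mul, ← add_assoc, antipodalCycle_add, antipodalCycle_add]
  simp

theorem isPeriodicCode_antipodalCycle {d : ℕ} (hd : 0 < d) (k : ℤ) :
    IsPeriodicCode k (2 * d) (antipodalCycle d) := by
  refine ⟨antipodalCycle_add_two_mul d, antipodalCycle_step hd, fun i t h0 h1 => ?_⟩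
  lift t to ℕ using h0
  by_cases ht : t ≤ d
  · have := le_hammingDist_antipodalCycle hd i ht
    omega
  · have h2 := le_hammingDist_antipodalCycle hd (i + t) (t := 2 * d - t) (by omega)
    rw [show i + (t : ℤ) + ((2 * d - t : ℕ) : ℤ) = i + 2 * d by omega,
      antipodalCycle_add_two_mul, hammingDist_comm] at h2
    omega

theorem two_mul_le_K {d k : ℕ} (hk : 1 ≤ k) (hd : 2 ≤ d) : 2 * d ≤ K d k :=
  IsPeriodicCode.le_K (X := antipodalCycle d)
    (by simpa using isPeriodicCode_antipodalCycle (by omega) (k : ℤ)) (by simp) hk (by omega)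

/-! ### Staircase products -/

/-- Let `y` be a closed walk of length `T` and `X` a code of length `N`. If the `s`-th step of `y`
is taken at height `P s` along `X`, and in total `q` turns around `X` are made, then the resulting
staircase in the product is a circuit code, provided that points with nearby first coordinate
are sufficiently spread. -/
theorem exists_isPeriodicCode_staircase {ι κ : Type*} [Fintype ι] [Fintype κ] {k N T q : ℤ}
    {y : ℤ → ι → Bool} {X : ℤ → κ → Bool} {P : ℤ → ℤ}
    (hyT : ∀ s, y (s + T) = y s) (hy : ∀ s, hammingDist (y s) (y (s + 1)) = 1)
    (hX : IsPeriodicCode k N X) (hP : Monotone P) (hPT : ∀ s, P (s + T) = P s + q * N)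
    (H : ∀ s s' h h', s ≤ s' → 2 * (s' - s) ≤ T → P (s - 1) ≤ h → h ≤ P s → P (s' - 1) ≤ h' →
      h' ≤ P s' → h ≤ h' →
      min k (s' - s + (h' - h)) ≤ (hammingDist (y s) (y s') + hammingDist (X h) (X h') : ℤ)) :
    ∃ Z : ℤ → ι ⊕ κ → Bool, IsPeriodicCode k (T + q * N) Z := by
  have hex : ∀ τ : ℤ, ∃ s : ℤ, s + P (s - 1) ≤ τ ∧ ∀ z : ℤ, z + P (z - 1) ≤ τ → z ≤ s := by
    intro τ
    refine Int.exists_greatest_of_bdd ⟨max 0 (τ - P (-1)), fun z hz => ?_⟩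
      ⟨min 0 (τ - P (-1)), ?_⟩
    · by_cases h0 : z ≤ 0
      · omega
      · have := hP (show -1 ≤ z - 1 by omega)
        omega
    · have := hP (show min 0 (τ - P (-1)) - 1 ≤ -1 by omega)
      omega
  choose σ hσ₁ hσ₂ using hex
  have hσ₃ : ∀ τ, τ - σ τ ≤ P (σ τ) := by
    intro τ
    by_contra hc
    have := hσ₂ τ (σ τ + 1) (by rw [add_sub_cancel_right]; omega)
    omega
  have hmono : ∀ τ τ', τ ≤ τ' → σ τ ≤ σ τ' := fun τ τ' h => hσ₂ τ' _ ((hσ₁ τ).trans h)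
  have huniq : ∀ τ s, s + P (s - 1) ≤ τ → τ - s ≤ P s → σ τ = s := by
    intro τ s h1 h2
    refine le_antisymm ?_ (hσ₂ τ s h1)
    by_contra hc
    have h3 := hP (show s ≤ σ τ - 1 by omega)
    have h4 := hσ₁ τ
    omega
  have hσT : ∀ τ, σ (τ + (T + q * N)) = σ τ + T := by
    intro τ
    have h1 := hσ₁ τ
    have h2 := hσ₃ τ
    refine huniq _ _ ?_ ?_
    · rw [show σ τ + T - 1 = σ τ - 1 + T by ring, hPT]; linarith
    · rw [hPT]; linarith
  have hZT : ∀ τ, Sum.elim (y (σ (τ + (T + q * N)))) (X (τ + (T + q * N) - σ (τ + (T + q * N))))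
      = Sum.elim (y (σ τ)) (X (τ - σ τ)) := by
    intro τ
    rw [hσT, hyT, show τ + (T + q * N) - (σ τ + T) = τ - σ τ + q * N by ring, hX.add_mul]
  have hnear : ∀ i j, i ≤ j → 2 * (σ j - σ i) ≤ T → min k (j - i) ≤
      hammingDist (Sum.elim (y (σ i)) (X (i - σ i))) (Sum.elim (y (σ j)) (X (j - σ j))) := by
    intro i j hij hT
    have h1 := hσ₁ i
    have h2 := hσ₁ j
    have h3 := hσ₃ i
    have h4 := hσ₃ j
    have h5 := hmono i j hij
    have h6 : i - σ i ≤ j - σ j := by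
      rcases h5.eq_or_lt with h | h
      · omega
      · have := hP (show σ i ≤ σ j - 1 by omega)
        omega
    have := H (σ i) (σ j) (i - σ i) (j - σ j) h5 hT (by omega) h3 (by omega) h4 h6
    rw [hammingDist_sumElim]
    push_cast
    omega
  refine ⟨fun τ => Sum.elim (y (σ τ)) (X (τ - σ τ)), hZT, fun τ => ?_, fun i t h0 h1 => ?_⟩
  · rw [hammingDist_sumElim]
    by_cases hc : τ + 1 - σ τ ≤ P (σ τ)
    · have h1 := hσ₁ τ
      rw [huniq (τ + 1) (σ τ) (by omega) hc, hammingDist_self, zero_add,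
        show τ + 1 - σ τ = τ - σ τ + 1 by ring, hX.step]
    · have h3 := hσ₃ τ
      have h4 := hP (show σ τ ≤ σ τ + 1 by omega)
      rw [huniq (τ + 1) (σ τ + 1) (by rw [add_sub_cancel_right]; omega) (by omega),
        show τ + 1 - (σ τ + 1) = τ - σ τ by ring, hammingDist_self, add_zero, hy]
  · by_cases hc : 2 * (σ (i + t) - σ i) ≤ T
    · have := hnear i (i + t) (by omega) hc
      omega
    · have h2 := hnear (i + t) (i + (T + q * N)) (by omega) (by rw [hσT]; omega)
      rw [hZT, hammingDist_comm] at h2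
      omega

/-- Dividing a cycle of length `N` into `W` windows of length at least `ω` yields
a quasiperiodic sequence of heights. -/
theorem exists_quasiperiodic_heights {N W ω : ℤ} (hW : 0 < W) (hω : 0 < ω) (hN : ω * W ≤ N) :
    ∃ F : ℤ → ℤ, (∀ w, F (w + W) = F w + N) ∧ (∀ w, F w + ω ≤ F (w + 1)) ∧
      ∀ w, ∃ r, 0 ≤ r ∧ ω * (r + 1) ≤ N ∧ N ∣ F w - ω * r := by
  refine ⟨fun w => N * (w / W) + ω * (w % W), fun w => ?_, fun w => ?_, fun w => ⟨w % W,
    Int.emod_nonneg w hW.ne', ?_, ⟨w / W, by ring⟩⟩⟩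
  · have h1 : (w + W) / W = w / W + 1 := by simpa using Int.add_mul_ediv_right w 1 hW.ne'
    simp only
    rw [h1, Int.add_emod_right]
    ring
  · have e := Int.emod_add_mul_ediv w W
    have b0 := Int.emod_nonneg w hW.ne'
    have b1 := Int.emod_lt_of_pos w hW
    simp only
    by_cases hc : w % W = W - 1
    · have e1 : w + 1 = 0 + (w / W + 1) * W := by linarith
      have h1 : (w + 1) / W = w / W + 1 := by
        rw [e1, Int.add_mul_ediv_right _ _ hW.ne']; simp
      have h2 : (w + 1) % W = 0 := by
        rw [e1, Int.add_mul_emod_self_right]; simp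
      rw [h1, h2, hc]
      linarith
    · have e1 : w + 1 = (w % W + 1) + (w / W) * W := by linarith
      have h1 : (w + 1) / W = w / W := by
        conv_lhs => rw [e1, Int.add_mul_ediv_right _ _ hW.ne',
          Int.ediv_eq_zero_of_lt (by omega) (by omega)]
        simp
      have h2 : (w + 1) % W = w % W + 1 := by
        conv_lhs => rw [e1, Int.add_mul_emod_self_right, Int.emod_eq_of_lt (by omega) (by omega)]
      rw [h1, h2]
      linarith
  · have b1 := Int.emod_lt_of_pos w hW
    exact (mul_le_mul_of_nonneg_left (by omega) hω.le).trans hN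

/-- Adding `k + 1` dimensions doubles the length of a circuit code of spread `k`. -/
theorem two_mul_K_le {b k : ℕ} (hk : 1 ≤ k) (h3 : 3 ≤ K b k) (hN : k + 1 ≤ K b k) :
    2 * K b k ≤ K (b + (k + 1)) k := by
  obtain ⟨X, hX⟩ := exists_isPeriodicCode_K h3
  set N := K b k
  obtain ⟨P, hPk, hPs, -⟩ := exists_quasiperiodic_heights (N := N) (W := k + 1) (ω := 1) (by omega)
    (by omega) (by omega)
  have hPt : ∀ (s : ℤ) (t : ℕ), P s + t ≤ P (s + t) := by
    intro s t
    induction t with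
    | zero => simp
    | succ t ih =>
      have := hPs (s + t)
      push_cast
      rw [← add_assoc, ← add_assoc]
      omega
  have hPmono : Monotone P := monotone_int_of_le_succ fun s => by have := hPs s; omega
  obtain ⟨Z, hZ⟩ := exists_isPeriodicCode_staircase (T := 2 * (k + 1 : ℕ)) (q := 2)
    (antipodalCycle_add_two_mul (k + 1)) (antipodalCycle_step (by omega)) hX hPmono
    (fun s => by
      rw [show s + 2 * ((k + 1 : ℕ) : ℤ) = s + (k + 1) + (k + 1) by push_cast; ring, hPk, hPk]
      ring)
    (by
      intro s s' h h' hs hT h1 h2 h4 h5 h6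
      obtain ⟨t, rfl⟩ := Int.le.dest hs
      have hd := le_hammingDist_antipodalCycle (d := k + 1) (by omega) s (t := t) (by omega)
      by_cases htk : k ≤ t
      · omega
      have hw := hPt (s + t) (k - t)
      rw [show s + (t : ℤ) + ((k - t : ℕ) : ℤ) = s - 1 + (k + 1) by omega, hPk] at hw
      have := hX.spread' h6 (by omega)
      omega)
  have hZ' : IsPeriodicCode (k : ℤ) ((2 * (k + 1) + 2 * N : ℕ) : ℤ) Z := by
    simpa using hZ
  have := hZ'.le_K (d := b + (k + 1)) (by simp; omega) hk (by omega)
  omega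

theorem two_pow_mul_le_K {b k : ℕ} (hk : 1 ≤ k) (hb : 2 ≤ b) (hkb : k ≤ b) (j : ℕ) :
    2 ^ j * (2 * b) ≤ K (b + j * (k + 1)) k := by
  induction j with
  | zero => simpa using two_mul_le_K hk hb
  | succ j ih =>
    have h1 : 1 * (2 * b) ≤ 2 ^ j * (2 * b) := Nat.mul_le_mul_right _ Nat.one_le_two_pow
    have h2 := two_mul_K_le (b := b + j * (k + 1)) hk (by omega) (by omega)
    rw [show b + (j + 1) * (k + 1) = b + j * (k + 1) + (k + 1) by ring, pow_succ]
    linarith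

theorem hammingDist_parity (a b c d : ℤ) :
    (hammingDist ![decide (a % 2 = 1), decide (b % 2 = 1)] ![decide (c % 2 = 1), decide (d % 2 = 1)]
      : ℤ) = (c - a) % 2 + (d - b) % 2 := by
  rw [hammingDist_pair]
  simp only [decide_eq_decide]
  split_ifs <;> push_cast <;> omega

/-- The product of a code `x` of even spread minus one and a code `X`, using two extra coordinates
to keep vertices of `x` of different parity apart. The `i`-th step of `x` is taken at height `p i`
along `X`. -/
theorem exists_isPeriodicCode_product {ι κ : Type*} [Fintype ι] [Fintype κ] {k M N q : ℤ}
    {x : ℤ → ι → Bool} {X : ℤ → κ → Bool} {p : ℤ → ℤ} (hk : 2 ≤ k) (hke : Even k)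
    (hM : 2 * k ≤ M) (hN : 0 < N)
    (hx : IsPeriodicCode (k - 1) M x) (hX : IsPeriodicCode k N X)
    (hpM : ∀ i, p (i + M) = p i + q * N) (hgap : ∀ i, p i + k ≤ p (i + 1))
    (hwidth : ∀ i, p (i + (k - 1)) ≤ p i + N - k)
    (hcross : ∀ i j, N ∣ p j - p i →
      hammingDist (x i) (x (j + 1)) = hammingDist (x i) (x j) + 1 ∧
      hammingDist (x (i + 1)) (x j) = hammingDist (x i) (x j) + 1) :
    ∃ Z : ℤ → (ι ⊕ Fin 2) ⊕ κ → Bool, IsPeriodicCode k (3 * M + q * N) Z := by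
  have hMe := hx.even_period (by omega)
  obtain ⟨M₂, hM₂⟩ := hMe
  obtain ⟨k₂, hk₂⟩ := hke
  have hp : Monotone p := monotone_int_of_le_succ fun i => by have := hgap i; omega
  refine exists_isPeriodicCode_staircase
    (y := fun s => Sum.elim (x ((s + 1) / 3))
      ![decide ((s + 2) / 3 % 2 = 1), decide (s / 3 % 2 = 1)])
    (P := fun s => p (s / 3)) (fun s => ?_) (fun s => ?_) hX
    (fun s s' h => hp (Int.ediv_le_ediv (by norm_num) h)) (fun s => ?_) ?_
  · rw [show (s + 3 * M + 1) / 3 = (s + 1) / 3 + M by omega, hx.periodic,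
      show (s + 3 * M + 2) / 3 % 2 = (s + 2) / 3 % 2 by omega,
      show (s + 3 * M) / 3 % 2 = s / 3 % 2 by omega]
  · rw [hammingDist_sumElim]
    zify
    rw [hammingDist_parity]
    by_cases hc : s % 3 = 1
    · rw [show (s + 1 + 1) / 3 = (s + 1) / 3 + 1 by omega, hx.step]
      omega
    · rw [show (s + 1 + 1) / 3 = (s + 1) / 3 by omega, hammingDist_self]
      omega
  · rw [show (s + 3 * M) / 3 = s / 3 + M by omega, hpM]
  · intro s s' h h' hs hT h1 h2 h3 h4 h5
    rw [hammingDist_sumElim]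
    push_cast
    rw [hammingDist_parity]
    have hu : (s + 1) / 3 ≤ (s' + 1) / 3 := by omega
    have hxd := hx.spread' hu (by omega)
    have hxe := hx.even_dist hu
    rw [← Int.even_coe_nat, Int.even_iff, Int.even_iff] at hxe
    by_cases hnear : (s' + 1) / 3 - (s + 1) / 3 ≤ k - 2
    · have w1 := hp (show (s + 1) / 3 - 1 ≤ (s - 1) / 3 by omega)
      have w2 := hp (show s' / 3 ≤ (s + 1) / 3 - 1 + (k - 1) by omega)
      have w3 := hwidth ((s + 1) / 3 - 1)
      have hXd := hX.spread' h5 (by omega)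
      by_cases hc : s / 3 + 1 ≤ (s' - 1) / 3
      · have w4 := hp hc
        have w5 := hgap (s / 3)
        omega
      · have hE : ((s' + 2) / 3 - (s + 2) / 3) % 2 = (s' + 2) / 3 - (s + 2) / 3 :=
          Int.emod_eq_of_lt (by omega) (by omega)
        have hF : (s' / 3 - s / 3) % 2 = s' / 3 - s / 3 :=
          Int.emod_eq_of_lt (by omega) (by omega)
        have hid : ∀ z : ℤ, z / 3 + (z + 1) / 3 + (z + 2) / 3 = z := fun z => by omega
        have he : ((s' + 2) / 3 - (s + 2) / 3) + (s' / 3 - s / 3) =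
            (s' - s) - ((s' + 1) / 3 - (s + 1) / 3) := by linarith [hid s, hid s']
        rw [hE, hF]
        omega
    · by_cases hf : k ≤ hammingDist (x ((s + 1) / 3)) (x ((s' + 1) / 3)) +
          (((s' + 2) / 3 - (s + 2) / 3) % 2 + (s' / 3 - s / 3) % 2)
      · omega
      have c0 : (s' / 3 - s / 3) % 2 = 0 := by omega
      have c1 : (s - 1) / 3 = s / 3 ∧ (s' - 1) / 3 = s' / 3 := by omega
      rw [c1.1] at h1
      rw [c1.2] at h3
      have hh : h' - h = p (s' / 3) - p (s / 3) := by omega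
      by_cases hdvd : N ∣ p (s' / 3) - p (s / 3)
      · obtain ⟨k1, k2⟩ := hcross _ _ hdvd
        have hi : s / 3 ≤ s' / 3 := by omega
        have hxi := hx.spread' hi (by omega)
        by_cases hc : s' % 3 = 2
        · have hx1 : hammingDist (x ((s + 1) / 3)) (x ((s' + 1) / 3))
              = hammingDist (x (s / 3)) (x (s' / 3)) + 1 := by
            rw [show (s + 1) / 3 = s / 3 by omega, show (s' + 1) / 3 = s' / 3 + 1 by omega, k1]
          by_cases hsm : s' / 3 - s / 3 ≤ k - 2
          · rcases hi.eq_or_lt with he | hlt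
            · rw [he] at hh
              omega
            · exfalso
              have w1 := hgap (s / 3)
              have w2 := hp (show s / 3 + 1 ≤ s' / 3 by omega)
              have w3 := hp (show s' / 3 ≤ s / 3 + (k - 1) by omega)
              have w4 := hwidth (s / 3)
              have := Int.le_of_dvd (by omega) hdvd
              omega
          · omega
        · have hx1 : hammingDist (x ((s + 1) / 3)) (x ((s' + 1) / 3))
              = hammingDist (x (s / 3)) (x (s' / 3)) + 1 := by
            rw [show (s + 1) / 3 = s / 3 + 1 by omega, show (s' + 1) / 3 = s' / 3 by omega, k2]
          omega
      · have := hX.one_le_dist (by omega) hN (i := h) (j := h') (by rwa [hh])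
        omega

/-! ### Choosing the heights -/

/-- Dividing `X` into `2k - 1` windows, each of which has a height reserved for every oriented
coordinate, heights can be chosen as required by `exists_isPeriodicCode_product`. -/
theorem exists_heights {m : ℕ} {k M N q : ℤ} {x : ℤ → Fin m → Bool} (hk : 2 ≤ k)
    (hM : 0 < M) (hx : IsPeriodicCode (k - 1) M x)
    (hN : (2 * m + k) * (2 * k - 1) ≤ N) (hq : M ≤ q * (2 * k - 1))
    (hq' : q * (2 * k - 1) ≤ 2 * M) :
    ∃ p : ℤ → ℤ, (∀ i, p (i + M) = p i + q * N) ∧ (∀ i, p i + k ≤ p (i + 1)) ∧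
      (∀ i, p (i + (k - 1)) ≤ p i + N - k) ∧
      ∀ i j, N ∣ p j - p i →
        hammingDist (x i) (x (j + 1)) = hammingDist (x i) (x j) + 1 ∧
        hammingDist (x (i + 1)) (x j) = hammingDist (x i) (x j) + 1 := by
  obtain ⟨F, hFW, hF1, hFr⟩ := exists_quasiperiodic_heights (N := N) (W := 2 * k - 1)
    (ω := 2 * m + k) (by omega) (by omega) hN
  have hFmono : Monotone F := monotone_int_of_le_succ fun w => by have := hF1 w; omega
  have hFlt : ∀ w w', w < w' → F w + (2 * m + k) ≤ F w' := fun w w' h =>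
    (hF1 w).trans (hFmono h)
  have hFq : ∀ w (c : ℤ), F (w + c * (2 * k - 1)) = F w + c * N := by
    intro w c
    induction c with
    | zero => simp
    | succ c ih => rw [add_mul, ← add_assoc, one_mul, hFW, ih]; ring
    | pred c ih =>
      have := hFW (w + (-c - 1) * (2 * k - 1))
      rw [show w + (-(c : ℤ) - 1) * (2 * k - 1) + (2 * k - 1) = w + -c * (2 * k - 1) by ring,
        ih] at this
      linarith
  have hflip : ∀ a b : Fin m → Bool, ∃ c : Fin m, hammingDist a b = 1 →
      b = Function.update a c (!a c) := by
    intro a b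
    by_cases h : hammingDist a b = 1
    · obtain ⟨c, hc⟩ := exists_update_of_hammingDist_eq_one h
      exact ⟨c, fun _ => hc⟩
    · have h1 : m ≠ 0 := by
        rintro rfl
        have := hx.step 0
        simp [hammingDist] at this
      exact ⟨⟨0, by omega⟩, fun h' => absurd h' h⟩
  choose C hC using hflip
  obtain ⟨c, hcdef⟩ : ∃ c : ℤ → Fin m, ∀ i, c i = C (x i) (x (i + 1)) := ⟨_, fun _ => rfl⟩
  have hcx : ∀ i, x (i + 1) = Function.update (x i) (c i) (!x i (c i)) := fun i => by
    rw [hcdef]; exact hC _ _ (hx.step i)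
  have hcM : ∀ i, c (i + M) = c i := fun i => by
    rw [hcdef, hcdef, hx.periodic, show i + M + 1 = i + 1 + M by ring, hx.periodic]
  obtain ⟨col, hcol⟩ : ∃ col : ℤ → ℤ, ∀ i, col i = 2 * (c i : ℕ) + if x i (c i) then 1 else 0 :=
    ⟨_, fun _ => rfl⟩
  have hcol0 : ∀ i, 0 ≤ col i := fun i => by rw [hcol]; split_ifs <;> omega
  have hcol1 : ∀ i, col i < 2 * m := fun i => by
    have := (c i).2
    rw [hcol]; split_ifs <;> omega
  have hcolM : ∀ i, col (i + M) = col i := fun i => by rw [hcol, hcol, hcM, hx.periodic]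
  obtain ⟨w, hw⟩ : ∃ w : ℤ → ℤ, ∀ i, w i = i * (q * (2 * k - 1)) / M := ⟨_, fun _ => rfl⟩
  have hwM : ∀ i, w (i + M) = w i + q * (2 * k - 1) := by
    intro i
    rw [hw, hw,
      show (i + M) * (q * (2 * k - 1)) = i * (q * (2 * k - 1)) + q * (2 * k - 1) * M by ring,
      Int.add_mul_ediv_right _ _ hM.ne']
  have hw1 : ∀ i, w i + 1 ≤ w (i + 1) := by
    intro i
    rw [hw, hw, ← Int.add_mul_ediv_right _ _ hM.ne']
    exact Int.ediv_le_ediv hM (by linarith)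
  have hw2 : ∀ i, w (i + (k - 1)) ≤ w i + (2 * k - 1) - 1 := by
    intro i
    rw [hw, hw, show ∀ z, z + (2 * k - 1) - 1 = z + 2 * (k - 1) by intro z; ring,
      ← Int.add_mul_ediv_right _ _ hM.ne']
    exact Int.ediv_le_ediv hM (by nlinarith)
  refine ⟨fun i => F (w i) + col i, fun i => ?_, fun i => ?_, fun i => ?_, fun i j hij => ?_⟩
  · simp only
    rw [hwM, hFq, hcolM]
    ring
  · have h1 := hFlt (w i) (w (i + 1)) (by have := hw1 i; omega)
    have h2 := hcol0 (i + 1)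
    have h3 := hcol1 i
    simp only
    omega
  · have h1 := hFlt (w (i + (k - 1))) (w i + (2 * k - 1)) (by have := hw2 i; omega)
    rw [hFW] at h1
    have h2 := hcol1 (i + (k - 1))
    have h3 := hcol0 i
    simp only
    omega
  · obtain ⟨r, hr0, hrN, hr⟩ := hFr (w i)
    obtain ⟨r', hr0', hrN', hr'⟩ := hFr (w j)
    have hi0 := hcol0 i
    have hi1 := hcol1 i
    have hj0 := hcol0 j
    have hj1 := hcol1 j
    have hdvd : N ∣ ((2 * m + k) * r' + col j) - ((2 * m + k) * r + col i) := by
      have h := dvd_add (dvd_sub hij hr') hr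
      ring_nf at h ⊢
      exact h
    have hp0 : 0 ≤ (2 * m + k) * r := mul_nonneg (by omega) hr0
    have hp0' : 0 ≤ (2 * m + k) * r' := mul_nonneg (by omega) hr0'
    have heq : (2 * m + k) * r' + col j = (2 * m + k) * r + col i := by
      have := Int.eq_zero_of_abs_lt_dvd hdvd (by rw [abs_lt]; constructor <;> linarith)
      linarith
    have hcc : col j = col i := by
      have h1 := congrArg (· % (2 * m + k)) heq
      simp only [Int.mul_add_emod_self_left] at h1
      rwa [Int.emod_eq_of_lt hj0 (by omega), Int.emod_eq_of_lt hi0 (by omega)] at h1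
    rw [hcol, hcol] at hcc
    have hc : c j = c i := by
      apply Fin.ext
      split_ifs at hcc <;> omega
    have hx' : x i (c i) = x j (c i) := by
      rw [hc] at hcc
      cases h1 : x i (c i) <;> cases h2 : x j (c i) <;> simp [h1, h2] at hcc ⊢
    constructor
    · rw [hcx j, hc]
      exact hammingDist_update_not hx'
    · rw [hammingDist_comm, hcx i, hammingDist_update_not hx'.symm, hammingDist_comm]

theorem heights_fit {k n N : ℕ} (hk : 2 ≤ k) (hn : (k + 2) ^ 2 ≤ n)
    (hN : 2 ^ (k + 1) * (2 * (n - (k + 1) * (k + 1))) ≤ N) : (2 * n + k) * (2 * k - 1) ≤ N := by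
  refine le_trans ?_ hN
  obtain ⟨r, rfl⟩ := Nat.exists_eq_add_of_le hn
  rw [show (k + 2) ^ 2 + r - (k + 1) * (k + 1) = 2 * k + 3 + r by
    rw [Nat.sub_eq_iff_eq_add (by nlinarith)]; ring]
  by_cases h4 : 4 ≤ k
  · have h2 : k ^ 2 ≤ 2 ^ k := by
      clear hn hN hk
      induction k, h4 using Nat.le_induction with
      | base => norm_num
      | succ k hk ih => rw [pow_succ 2]; nlinarith
    obtain ⟨l, rfl⟩ := Nat.exists_eq_add_of_le h4
    rw [show 2 * (4 + l) - 1 = 2 * l + 7 by omega, pow_succ 2 (4 + l)]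
    have := Nat.mul_le_mul_right (2 * (2 * (2 * (4 + l) + 3 + r))) h2
    refine le_trans (b := (4 + l) ^ 2 * (2 * (2 * (2 * (4 + l) + 3 + r)))) ?_ (by linarith)
    nlinarith [Nat.zero_le (l ^ 3), Nat.zero_le (l ^ 2), Nat.zero_le (r * l),
      Nat.zero_le (r * l ^ 2)]
  · interval_cases k <;> omega

/-- For even `k ≥ 2` and `(k+2)² ≤ m ≤ n`, `k·K(m+n+2,k) ≥ K(m,k−1)·K(n,k)`. -/
theorem stmt_4 (k m n : ℕ) (hk : 2 ≤ k) (hke : Even k)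
    (hm : (k + 2) ^ 2 ≤ m) (hmn : m ≤ n) :
    K m (k - 1) * K n k ≤ k * K (m + n + 2) k := by
  have hkm : (k + 1) * (k + 1) + (2 * k + 3) ≤ m := by nlinarith
  have hM := two_mul_le_K (d := m) (k := k - 1) (by omega) (by omega)
  have hN := two_pow_mul_le_K (b := n - (k + 1) * (k + 1)) (k := k) (by omega) (by omega) (by omega)
    (k + 1)
  rw [Nat.sub_add_cancel (by omega)] at hN
  have hfit := heights_fit hk (hm.trans hmn) hN
  have hN3 : 3 ≤ K n k := le_trans (by nlinarith [show 3 ≤ 2 * k - 1 by omega]) hfit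
  obtain ⟨x, hx⟩ := exists_isPeriodicCode_K (d := m) (k := k - 1) (by omega)
  obtain ⟨X, hX⟩ := exists_isPeriodicCode_K hN3
  set M := K m (k - 1)
  set N := K n k
  obtain ⟨q, hq1, hq2⟩ : ∃ q : ℕ, M ≤ k * q ∧ k * q ≤ M + (k - 1) :=
    ⟨(M + (k - 1)) / k, by
      have := Nat.lt_mul_div_succ (M + (k - 1)) (show 0 < k by omega)
      rw [mul_add] at this
      omega, Nat.mul_div_le _ _⟩
  obtain ⟨l, rfl⟩ := Nat.exists_eq_add_of_le hk
  rw [show 2 + l - 1 = l + 1 by omega] at *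
  have hx' : IsPeriodicCode (((2 + l : ℕ) : ℤ) - 1) M x := by
    convert hx using 1
    push_cast
    ring
  rw [show 2 * (2 + l) - 1 = 2 * l + 3 by omega] at hfit
  obtain ⟨p, hp1, hp2, hp3, hp4⟩ := exists_heights (k := (2 + l : ℕ)) (N := N) (q := q) (by omega)
    (by omega) hx' (by
      rw [show 2 * ((2 + l : ℕ) : ℤ) - 1 = 2 * l + 3 by push_cast; ring]
      have : (2 * m + (2 + l)) * (2 * l + 3) ≤ N :=
        (Nat.mul_le_mul_right _ (by omega)).trans hfit
      exact_mod_cast this)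
    (by
      rw [show 2 * ((2 + l : ℕ) : ℤ) - 1 = 2 * l + 3 by push_cast; ring]
      exact_mod_cast (by nlinarith : M ≤ q * (2 * l + 3)))
    (by
      rw [show 2 * ((2 + l : ℕ) : ℤ) - 1 = 2 * l + 3 by push_cast; ring]
      have h1 : (2 + l) * (q * (2 * l + 3)) ≤ (2 + l) * (2 * M) := by nlinarith
      exact_mod_cast Nat.le_of_mul_le_mul_left h1 (by omega))
  obtain ⟨Z, hZ⟩ := exists_isPeriodicCode_product (by omega) (by exact_mod_cast hke)
    (by push_cast; nlinarith) (by omega) hx' hX hp1 hp2 hp3 hp4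
  have hle := IsPeriodicCode.le_K (d := m + n + 2) (k := 2 + l) (N := 3 * M + q * N) (X := Z)
    (by push_cast at hZ ⊢; exact hZ) (by simp; omega) (by omega) (by omega)
  calc M * N ≤ (2 + l) * q * N := Nat.mul_le_mul_right _ hq1
    _ ≤ (2 + l) * (3 * M + q * N) := by nlinarith
    _ ≤ _ := Nat.mul_le_mul_left _ hle
end
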